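/- arXiv:1903.04331 — 7 statements merged into one kernel-verified Lean document; each statement's English description precedes it below -/
import Mathlib

section
/- For every p ∈ [1, ∞) and every β > −1 there exists a constant C > 0 (depending only on p and β) such that: for every n ≥ 1, every r ∈ [0, 1), and every rational function f = P/Q, where P and Q are complex polynomials of degree at most n and Q(ζ) ≠ 0 for every ζ ∈ ℂ with r·|ζ| < 1, one has sup_{z∈D} |f(z)| ≤ C · (n/(1−r))^{(2+β)/p} · ‖f‖_{A^p(β)}. (Upper bound in Theorem 2.3: the embedding of H^∞ into A^p(β) is invertible on rational functions of degree n with poles of modulus at least 1/r.) -/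
open Complex Metric

noncomputable section

/-- The radial-weighted Bergman norm
`‖f‖_{A^p(β)} = (∫_D |f|^p (1-|z|^2)^β dA)^{1/p}`, `dA` normalized area measure. -/
def bergmanNorm (p β : ℝ) (f : ℂ → ℂ) : ℝ :=
  (Real.pi⁻¹ * ∫ z in ball (0:ℂ) 1, ‖f z‖ ^ p * (1 - ‖z‖ ^ 2) ^ β) ^ (1 / p)

open MeasureTheory ComplexConjugate

/-- A polynomial dominated by a zero-free one on the unit circle obeys a Bernstein–Walsh type
bound outside the unit disc. -/
lemma norm_eval_le_of_circle {P Q : Polynomial ℂ} {n : ℕ} {M : ℝ} (hP : P.natDegree ≤ n)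
    (hQ : ∀ ζ : ℂ, ‖ζ‖ ≤ 1 → Q.eval ζ ≠ 0)
    (hM : ∀ ζ : ℂ, ‖ζ‖ = 1 → ‖P.eval ζ‖ ≤ M * ‖Q.eval ζ‖) {z : ℂ} (hz : 1 ≤ ‖z‖) :
    ‖P.eval z‖ ≤ M * ‖z‖ ^ n * ‖Q.eval (conj z)⁻¹‖ := by
  have hrefl : ∀ w : ℂ, w ≠ 0 → (P.reflect n).eval w⁻¹ * w ^ n = P.eval w := by
    intro w hw
    let _ : Invertible w := invertibleOfNonzero hw
    have := Polynomial.eval₂_reflect_mul_pow (RingHom.id ℂ) w n P hP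
    simpa using this
  have hconj : ∀ w : ℂ, (Q.map (starRingEnd ℂ)).eval w = conj (Q.eval (conj w)) := by
    intro w
    have := Polynomial.eval_map_apply (p := Q) (f := starRingEnd ℂ) (conj w)
    simpa using this
  have hdiff : DifferentiableOn ℂ
      (fun w => (P.reflect n).eval w / (Q.map (starRingEnd ℂ)).eval w) (closedBall 0 1) := by
    refine (Polynomial.differentiable _).differentiableOn.div
      (Polynomial.differentiable _).differentiableOn fun w hw => ?_
    rw [hconj, Ne, map_eq_zero]
    exact hQ _ (by simpa using hw)
  have hz0 : z ≠ 0 := norm_pos_iff.1 (by linarith)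
  have hmain : ‖(P.reflect n).eval z⁻¹ / (Q.map (starRingEnd ℂ)).eval z⁻¹‖ ≤ M := by
    refine norm_le_of_forall_mem_frontier_norm_le (U := ball (0 : ℂ) 1) (F := ℂ)
      (f := fun w => (P.reflect n).eval w / (Q.map (starRingEnd ℂ)).eval w)
      isBounded_ball ?_ ?_ ?_
    · exact DifferentiableOn.diffContOnCl (by rwa [closure_ball _ one_ne_zero])
    · intro w hw
      rw [frontier_ball _ one_ne_zero, mem_sphere_zero_iff_norm] at hw
      have hw0 : w ≠ 0 := norm_pos_iff.1 (by linarith)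
      have h1 := hrefl w⁻¹ (inv_ne_zero hw0)
      rw [inv_inv] at h1
      have h2 : ‖(P.reflect n).eval w‖ = ‖P.eval w⁻¹‖ := by
        rw [← h1]; simp [hw]
      have h3 : conj w = w⁻¹ := by
        rw [Complex.inv_def, normSq_eq_norm_sq, hw]; simp
      have h4 : Q.eval w⁻¹ ≠ 0 := hQ _ (by simp [hw])
      rw [norm_div, h2, hconj, h3, RCLike.norm_conj, div_le_iff₀ (norm_pos_iff.2 h4)]
      exact hM _ (by simp [hw])
    · rw [closure_ball _ one_ne_zero]
      simpa using inv_le_one_of_one_le₀ hz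
  have h5 : Q.eval (conj z)⁻¹ ≠ 0 := hQ _ (by simpa using inv_le_one_of_one_le₀ hz)
  rw [hconj, norm_div, RCLike.norm_conj, map_inv₀, div_le_iff₀ (norm_pos_iff.2 h5)] at hmain
  rw [← hrefl z hz0, norm_mul, norm_pow]
  calc _ ≤ M * ‖Q.eval (conj z)⁻¹‖ * ‖z‖ ^ n := by gcongr
    _ = _ := by ring

/-- Comparison of the values of a polynomial at two points that are close to each other relative
to their distances to the roots. -/
lemma norm_eval_le_pow_mul_norm_eval {Q : Polynomial ℂ} {n : ℕ} {t : ℝ} {w z : ℂ}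
    (hQ : Q.natDegree ≤ n) (ht : 0 ≤ t) (h : ∀ a ∈ Q.roots, ‖w - z‖ ≤ t * ‖z - a‖) :
    ‖Q.eval w‖ ≤ (1 + t) ^ n * ‖Q.eval z‖ := by
  have hs := IsAlgClosed.splits Q
  have hnorm : ∀ x : ℂ, ‖(Q.roots.map (x - ·)).prod‖ = (Q.roots.map (fun a => ‖x - a‖)).prod := by
    intro x
    have := map_multiset_prod (normHom : ℂ →*₀ ℝ) (Q.roots.map (x - ·))
    simpa [Multiset.map_map, Function.comp_def] using this
  have hprod : (Q.roots.map (fun a => ‖w - a‖)).prod ≤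
      (1 + t) ^ n * (Q.roots.map (fun a => ‖z - a‖)).prod := by
    calc (Q.roots.map (fun a => ‖w - a‖)).prod
        ≤ (Q.roots.map (fun a => (1 + t) * ‖z - a‖)).prod := by
          refine Multiset.prod_map_le_prod_map₀ _ _ (fun _ _ => norm_nonneg _) fun a ha => ?_
          have h1 := norm_add_le (w - z) (z - a)
          rw [sub_add_sub_cancel] at h1
          linarith [h a ha]
      _ = (1 + t) ^ Q.roots.card * (Q.roots.map (fun a => ‖z - a‖)).prod := by
          rw [Multiset.prod_map_mul]; simp
      _ ≤ _ := by
          refine mul_le_mul_of_nonneg_right (pow_le_pow_right₀ (by linarith)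
            ((Polynomial.card_roots' Q).trans hQ)) ?_
          refine Multiset.prod_nonneg fun x hx => ?_
          obtain ⟨a, -, rfl⟩ := Multiset.mem_map.1 hx
          exact norm_nonneg _
  rw [hs.eval_eq_prod_roots w, hs.eval_eq_prod_roots z, norm_mul, norm_mul, hnorm, hnorm]
  calc _ ≤ ‖Q.leadingCoeff‖ * ((1 + t) ^ n * (Q.roots.map (fun a => ‖z - a‖)).prod) := by gcongr
    _ = _ := by ring

/-- A rational function of degree `n` with poles of modulus at least `1 / r` grows by at most a
constant factor on a disc slightly larger than the unit disc. -/
lemma norm_eval_div_le_of_circle {P Q : Polynomial ℂ} {n : ℕ} {r M : ℝ} (hn : 1 ≤ n)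
    (hr0 : 0 ≤ r) (hr1 : r < 1) (hP : P.natDegree ≤ n) (hQ : Q.natDegree ≤ n)
    (hpole : ∀ ζ : ℂ, r * ‖ζ‖ < 1 → Q.eval ζ ≠ 0)
    (hM : ∀ ζ : ℂ, ‖ζ‖ ≤ 1 → ‖P.eval ζ / Q.eval ζ‖ ≤ M) {z : ℂ}
    (hz : ‖z‖ < 1 + (1 - r) / (2 * n)) :
    Q.eval z ≠ 0 ∧ ‖P.eval z / Q.eval z‖ ≤ Real.exp 3 * M := by
  have hM0 : 0 ≤ M := (norm_nonneg _).trans (hM 0 (by simp))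
  have hn' : (1 : ℝ) ≤ n := by exact_mod_cast hn
  set ε : ℝ := (1 - r) / (2 * n) with hε
  have hεn : n * ε = (1 - r) / 2 := by rw [hε]; field_simp
  have hε0 : 0 < ε := by rw [hε]; exact div_pos (by linarith) (by linarith)
  have hε1 : ε ≤ (1 - r) / 2 := by rw [← hεn]; nlinarith
  have hQ1 : ∀ ζ : ℂ, ‖ζ‖ ≤ 1 → Q.eval ζ ≠ 0 := fun ζ hζ => hpole ζ (by nlinarith [norm_nonneg ζ])
  have hQz : Q.eval z ≠ 0 := hpole z (by nlinarith [norm_nonneg z])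
  refine ⟨hQz, ?_⟩
  rcases le_total ‖z‖ 1 with hz1 | hz1
  · exact (hM z hz1).trans (le_mul_of_one_le_left hM0 (Real.one_le_exp (by norm_num)))
  have h1 := norm_eval_le_of_circle (M := M) hP hQ1 (fun ζ hζ => by
    have := hM ζ hζ.le
    rwa [norm_div, div_le_iff₀ (norm_pos_iff.2 (hQ1 ζ hζ.le))] at this) hz1
  have hz0 : z ≠ 0 := norm_pos_iff.1 (by linarith)
  have hdist : ‖(conj z)⁻¹ - z‖ ≤ 2 * ε := by
    have : (conj z)⁻¹ - z = (conj z)⁻¹ * ((1 - ‖z‖ ^ 2 : ℝ) : ℂ) := by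
      have hc : conj z ≠ 0 := by simpa using hz0
      have : conj z * z = ((‖z‖ ^ 2 : ℝ) : ℂ) := by
        rw [mul_comm, mul_conj, normSq_eq_norm_sq]
      push_cast at this ⊢
      rw [← this]; field_simp
    rw [this, norm_mul, norm_inv, RCLike.norm_conj, norm_real, Real.norm_eq_abs,
      abs_of_nonpos (by nlinarith), inv_mul_le_iff₀ (by linarith)]
    nlinarith
  have h2 := norm_eval_le_pow_mul_norm_eval (Q := Q) (n := n) (t := 2 / n) (w := (conj z)⁻¹)
    (z := z) hQ (by positivity) (fun a ha => by
      have hra : 1 ≤ r * ‖a‖ := by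
        by_contra! hlt
        exact hpole a hlt (Polynomial.isRoot_of_mem_roots ha)
      have ha2 : 2 - r ≤ ‖a‖ := by
        by_contra! hlt
        have : 0 < r := by
          rcases hr0.eq_or_lt with h | h
          · rw [← h] at hra; linarith
          · exact h
        nlinarith [sq_nonneg (1 - r)]
      have h3 := norm_sub_norm_le a z
      rw [norm_sub_rev] at h3
      have h4 : n * ε ≤ ‖z - a‖ := by linarith
      rw [div_mul_eq_mul_div, le_div_iff₀ (by linarith)]
      nlinarith)
  have h3 : (1 + 2 / (n : ℝ)) ^ n ≤ Real.exp 2 := by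
    calc (1 + 2 / (n : ℝ)) ^ n ≤ (Real.exp (2 / n)) ^ n := by
          gcongr
          linarith [Real.add_one_le_exp (2 / (n : ℝ))]
      _ = Real.exp 2 := by rw [← Real.exp_nat_mul]; congr 1; field_simp
  have h4 : ‖z‖ ^ n ≤ Real.exp 1 := by
    calc ‖z‖ ^ n ≤ (Real.exp ε) ^ n := by
          gcongr
          linarith [Real.add_one_le_exp ε]
      _ ≤ Real.exp 1 := by rw [← Real.exp_nat_mul]; gcongr; linarith
  rw [norm_div, div_le_iff₀ (norm_pos_iff.2 hQz)]
  calc ‖P.eval z‖ ≤ M * ‖z‖ ^ n * ‖Q.eval (conj z)⁻¹‖ := h1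
    _ ≤ M * Real.exp 1 * (Real.exp 2 * ‖Q.eval z‖) := by
        gcongr
        exact h2.trans (by gcongr)
    _ = Real.exp 3 * M * ‖Q.eval z‖ := by
        rw [show (3 : ℝ) = 1 + 2 by norm_num, Real.exp_add]; ring

/-- The standard weight `(1 - |z|²)^β`, `β > -1`, is integrable on the unit disc. -/
lemma integrableOn_one_sub_norm_sq_rpow {β : ℝ} (hβ : -1 < β) :
    IntegrableOn (fun z : ℂ => (1 - ‖z‖ ^ 2) ^ β) (ball 0 1) := by
  have hI : IntegrableOn (fun y : ℝ => y * (1 - y ^ 2) ^ β) (Set.Ioo 0 1) := by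
    have h1 : IntervalIntegrable (fun y : ℝ => (1 - y) ^ β) volume 1 0 := by
      simpa using (intervalIntegral.intervalIntegrable_rpow' (a := 0) (b := 1) hβ).comp_sub_left 1
    have h2 : IntervalIntegrable (fun y : ℝ => (1 - y) ^ β * (y * (1 + y) ^ β)) volume 0 1 := by
      refine h1.symm.mul_continuousOn (continuousOn_id.mul ?_)
      refine ContinuousOn.rpow_const (by fun_prop) fun y hy => Or.inl ?_
      rw [Set.uIcc_of_le zero_le_one] at hy
      linarith [hy.1]
    rw [intervalIntegrable_iff_integrableOn_Ioo_of_le zero_le_one] at h2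
    refine h2.congr_fun (fun y hy => ?_) measurableSet_Ioo
    have : (1 - y ^ 2) = (1 - y) * (1 + y) := by ring
    simp only [this]
    rw [Real.mul_rpow (by linarith [hy.2]) (by linarith [hy.1])]
    ring
  have h := (integrable_fun_norm_addHaar (volume : Measure ℂ)
    (f := (Set.Iio (1 : ℝ)).indicator fun y => (1 - y ^ 2) ^ β)).2 (by
      have h3 : (fun y : ℝ => y ^ (Module.finrank ℝ ℂ - 1) •
          (Set.Iio (1 : ℝ)).indicator (fun y => (1 - y ^ 2) ^ β) y) =
          (Set.Iio (1 : ℝ)).indicator fun y => y * (1 - y ^ 2) ^ β := by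
        ext y
        by_cases hy : y < 1 <;> simp [Complex.finrank_real_complex, Set.indicator, hy]
      rw [h3, IntegrableOn, integrable_indicator_iff measurableSet_Iio, IntegrableOn,
        Measure.restrict_restrict measurableSet_Iio, Set.Iio_inter_Ioi]
      exact hI)
  have h4 : (fun z : ℂ => (Set.Iio (1 : ℝ)).indicator (fun y => (1 - y ^ 2) ^ β) ‖z‖) =
      (ball (0 : ℂ) 1).indicator fun z => (1 - ‖z‖ ^ 2) ^ β := by
    ext z
    by_cases hz : ‖z‖ < 1 <;> simp [Set.indicator, hz]
  rw [h4, integrable_indicator_iff measurableSet_ball] at h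
  exact h

/-- A function continuous on the closed disc that stays at least `m` in modulus near a boundary
point has a Bergman norm bounded below. -/
lemma bergmanNorm_ge_of_le_norm_near {p β : ℝ} (hp : 1 ≤ p) (hβ : -1 < β) {f : ℂ → ℂ}
    (hf : ContinuousOn f (closedBall 0 1)) {z₀ : ℂ} (hz₀ : ‖z₀‖ = 1) {δ m : ℝ} (hδ0 : 0 < δ)
    (hδ1 : δ ≤ 1) (hm : 0 ≤ m) (h : ∀ z, ‖z - z₀‖ < δ → m ≤ ‖f z‖) :
    m * (min ((1 / 4 : ℝ) ^ β) ((3 / 2 : ℝ) ^ β) / 16) ^ (1 / p) * δ ^ ((2 + β) / p) ≤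
      bergmanNorm p β f := by
  have hp0 : 0 < p := by linarith
  set c := min ((1 / 4 : ℝ) ^ β) ((3 / 2 : ℝ) ^ β) with hc
  have hc0 : 0 < c := by positivity
  have hint : IntegrableOn (fun z => ‖f z‖ ^ p * (1 - ‖z‖ ^ 2) ^ β) (ball (0 : ℂ) 1) := by
    obtain ⟨B, hB⟩ := (isCompact_closedBall (0 : ℂ) 1).exists_bound_of_continuousOn hf
    refine Integrable.bdd_mul (c := B ^ p) (integrableOn_one_sub_norm_sq_rpow hβ) ?_ ?_
    · exact ((hf.mono ball_subset_closedBall).norm.rpow_const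
        fun _ _ => Or.inr hp0.le).aestronglyMeasurable measurableSet_ball
    · refine (ae_restrict_iff' measurableSet_ball).2 (Filter.Eventually.of_forall fun z hz => ?_)
      rw [Real.norm_of_nonneg (by positivity)]
      exact Real.rpow_le_rpow (norm_nonneg _) (hB z (ball_subset_closedBall hz)) hp0.le
  set w₀ : ℂ := ((1 - δ / 2 : ℝ) : ℂ) * z₀ with hw₀
  have hw₀n : ‖w₀‖ = 1 - δ / 2 := by
    rw [hw₀, norm_mul, hz₀, norm_real, Real.norm_of_nonneg (by linarith), mul_one]
  have hw₀z : ‖w₀ - z₀‖ = δ / 2 := by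
    have : w₀ - z₀ = ((-(δ / 2) : ℝ) : ℂ) * z₀ := by rw [hw₀]; push_cast; ring
    rw [this, norm_mul, hz₀, norm_real, norm_neg, Real.norm_of_nonneg (by linarith), mul_one]
  have hball : ∀ z ∈ ball w₀ (δ / 4), ‖z‖ ≤ 1 - δ / 4 ∧ 1 - 3 * δ / 4 ≤ ‖z‖ ∧ ‖z - z₀‖ < δ := by
    intro z hz
    rw [mem_ball_iff_norm] at hz
    have h1 := norm_sub_norm_le z w₀
    have h2 := norm_sub_norm_le w₀ z
    have h3 := norm_add_le (z - w₀) (w₀ - z₀)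
    rw [norm_sub_rev] at h2
    rw [sub_add_sub_cancel] at h3
    exact ⟨by linarith, by linarith, by linarith⟩
  have hsub : ball w₀ (δ / 4) ⊆ ball 0 1 := fun z hz => by
    rw [mem_ball_zero_iff]
    linarith [(hball z hz).1]
  have hweight : ∀ z ∈ ball w₀ (δ / 4), c * δ ^ β ≤ (1 - ‖z‖ ^ 2) ^ β := by
    intro z hz
    obtain ⟨h1, h2, -⟩ := hball z hz
    have hlo : 1 / 4 * δ ≤ 1 - ‖z‖ ^ 2 := by nlinarith [norm_nonneg z]
    have hhi : 1 - ‖z‖ ^ 2 ≤ 3 / 2 * δ := by nlinarith [norm_nonneg z]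
    rcases le_total 0 β with hb | hb
    · calc c * δ ^ β ≤ (1 / 4) ^ β * δ ^ β := by gcongr; exact min_le_left _ _
        _ = (1 / 4 * δ) ^ β := (Real.mul_rpow (by norm_num) hδ0.le).symm
        _ ≤ _ := by gcongr
    · calc c * δ ^ β ≤ (3 / 2) ^ β * δ ^ β := by gcongr; exact min_le_right _ _
        _ = (3 / 2 * δ) ^ β := (Real.mul_rpow (by norm_num) hδ0.le).symm
        _ ≤ _ := Real.rpow_le_rpow_of_nonpos (by linarith) hhi hb
  have hlower : m ^ p * (c * δ ^ β) * (δ ^ 2 / 16 * Real.pi) ≤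
      ∫ z in ball (0 : ℂ) 1, ‖f z‖ ^ p * (1 - ‖z‖ ^ 2) ^ β := by
    have hvol : volume.real (ball w₀ (δ / 4)) = δ ^ 2 / 16 * Real.pi := by
      rw [Measure.real, Complex.volume_ball, ENNReal.toReal_mul, ENNReal.toReal_pow,
        ENNReal.toReal_ofReal (by linarith)]
      simp only [ENNReal.coe_toReal, NNReal.coe_real_pi]
      ring
    calc _ ≤ ∫ z in ball w₀ (δ / 4), ‖f z‖ ^ p * (1 - ‖z‖ ^ 2) ^ β := by
          rw [← hvol]
          refine setIntegral_ge_of_const_le_real measurableSet_ball measure_ball_lt_top.ne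
            (fun z hz => ?_) (hint.mono_set hsub)
          have := h z (hball z hz).2.2
          have := hweight z hz
          gcongr
      _ ≤ _ := by
          refine setIntegral_mono_set hint ?_ hsub.eventuallyLE
          refine (ae_restrict_iff' measurableSet_ball).2 (Filter.Eventually.of_forall fun z hz => ?_)
          have hz1 : ‖z‖ < 1 := by simpa using hz
          exact mul_nonneg (by positivity) (Real.rpow_nonneg (by nlinarith [norm_nonneg z]) _)
  rw [bergmanNorm]
  calc m * (c / 16) ^ (1 / p) * δ ^ ((2 + β) / p)
      = (m ^ p * (c / 16) * δ ^ (2 + β)) ^ (1 / p) := by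
        rw [Real.mul_rpow (by positivity) (by positivity),
          Real.mul_rpow (by positivity) (by positivity), ← Real.rpow_mul hm,
          ← Real.rpow_mul hδ0.le, mul_one_div_cancel hp0.ne', Real.rpow_one, mul_one_div]
    _ ≤ _ := by
        refine Real.rpow_le_rpow (by positivity) ?_ (by positivity)
        rw [le_inv_mul_iff₀ Real.pi_pos]
        refine le_trans (le_of_eq ?_) hlower
        rw [Real.rpow_add hδ0, Real.rpow_two]
        ring

/-- Upper bound in Theorem 2.3: there is `C > 0` (depending only on `p, β`) such
that every rational function `f = P/Q ∈ R_{n,r}` (degrees at most `n`, all poles of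
modulus at least `1/r`) satisfies
`sup_{z ∈ D} |f(z)| ≤ C (n/(1-r))^{(2+β)/p} ‖f‖_{A^p(β)}`. -/
theorem embedding_upper_bound (p β : ℝ) (hp : 1 ≤ p) (hβ : -1 < β) :
    ∃ C : ℝ, 0 < C ∧
      ∀ (n : ℕ), 1 ≤ n → ∀ r : ℝ, 0 ≤ r → r < 1 →
      ∀ P Q : Polynomial ℂ, P.natDegree ≤ n → Q.natDegree ≤ n →
      (∀ ζ : ℂ, r * ‖ζ‖ < 1 → Q.eval ζ ≠ 0) →
      ∀ z ∈ ball (0:ℂ) 1,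
        ‖P.eval z / Q.eval z‖ ≤
          C * ((n : ℝ) / (1 - r)) ^ ((2 + β) / p) *
            bergmanNorm p β (fun w => P.eval w / Q.eval w) := by
  set K := Real.exp 3 with hK
  have hK0 : 0 < K := Real.exp_pos 3
  set A := (min ((1 / 4 : ℝ) ^ β) ((3 / 2 : ℝ) ^ β) / 16) ^ (1 / p) with hA
  have hA0 : 0 < A := by positivity
  set κ : ℝ := 1 / (4 * (K + 1)) with hκ
  have hκ0 : 0 < κ := by positivity
  set s := (2 + β) / p with hs
  refine ⟨2 / (A * κ ^ s), by positivity, ?_⟩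
  intro n hn r hr0 hr1 P Q hP hQ hpole z hz
  have hn' : (1 : ℝ) ≤ n := by exact_mod_cast hn
  have hr' : 0 < 1 - r := by linarith
  set f : ℂ → ℂ := fun w => P.eval w / Q.eval w with hf
  have hdiff : DifferentiableOn ℂ f (closedBall 0 1) := by
    refine P.differentiable.differentiableOn.div Q.differentiable.differentiableOn fun w hw => ?_
    rw [mem_closedBall_zero_iff] at hw
    exact hpole w (by nlinarith [norm_nonneg w])
  obtain ⟨z₀, hz₀, hmax⟩ := Complex.exists_mem_frontier_isMaxOn_norm (f := f)
    (isBounded_ball (x := (0 : ℂ)) (r := 1)) ⟨0, by simp⟩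
    (DifferentiableOn.diffContOnCl (by rwa [closure_ball _ one_ne_zero]))
  rw [frontier_ball _ one_ne_zero, mem_sphere_zero_iff_norm] at hz₀
  rw [closure_ball _ one_ne_zero] at hmax
  have hM : ∀ ζ : ℂ, ‖ζ‖ ≤ 1 → ‖f ζ‖ ≤ ‖f z₀‖ := fun ζ hζ =>
    hmax (mem_closedBall_zero_iff.2 hζ)
  set M := ‖f z₀‖ with hMdef
  set ε : ℝ := (1 - r) / (2 * n) with hε
  have hε0 : 0 < ε := by positivity
  have hgrow : ∀ w ∈ ball z₀ ε, Q.eval w ≠ 0 ∧ ‖f w‖ ≤ K * M := by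
    intro w hw
    rw [mem_ball_iff_norm] at hw
    refine norm_eval_div_le_of_circle hn hr0 hr1 hP hQ hpole hM ?_
    linarith [norm_sub_norm_le w z₀]
  have hδ : κ * ((1 - r) / n) = ε / (2 * (K + 1)) := by
    rw [hκ, hε]; field_simp; norm_num
  have hδε : ε / (2 * (K + 1)) < ε := div_lt_self hε0 (by linarith)
  have hnear : ∀ w, ‖w - z₀‖ < κ * ((1 - r) / n) → M / 2 ≤ ‖f w‖ := by
    intro w hw
    rw [hδ] at hw
    have hschwarz := dist_le_div_mul_dist_of_mapsTo_ball (f := f) (c := z₀) (z := w) (R₁ := ε)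
      (R₂ := (K + 1) * M)
      (P.differentiable.differentiableOn.div Q.differentiable.differentiableOn
        fun w hw => (hgrow w hw).1)
      (fun w hw => by
        rw [mem_closedBall_iff_norm]
        linarith [norm_sub_le (f w) (f z₀), (hgrow w hw).2])
      (by rw [mem_ball_iff_norm]; linarith)
    rw [dist_eq_norm, dist_eq_norm] at hschwarz
    have : (K + 1) * M / ε * ‖w - z₀‖ ≤ M / 2 := by
      calc _ ≤ (K + 1) * M / ε * (ε / (2 * (K + 1))) := by gcongr
        _ = M / 2 := by field_simp
    have h2 := norm_sub_norm_le (f z₀) (f w)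
    rw [norm_sub_rev] at h2
    linarith
  have hε1 : ε ≤ 1 := by
    rw [hε, div_le_one (by positivity)]
    linarith
  have hlow := bergmanNorm_ge_of_le_norm_near hp hβ hdiff.continuousOn hz₀
    (δ := κ * ((1 - r) / n)) (m := M / 2) (by positivity) (by rw [hδ]; linarith)
    (by positivity) hnear
  have hz1 : ‖z‖ ≤ 1 := (mem_ball_zero_iff.1 hz).le
  have hinv : ((n : ℝ) / (1 - r)) ^ s * ((1 - r) / n) ^ s = 1 := by
    rw [← Real.mul_rpow (by positivity) (by positivity)]
    have : (n : ℝ) / (1 - r) * ((1 - r) / n) = 1 := by field_simp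
    rw [this, Real.one_rpow]
  calc ‖f z‖ ≤ M := hM z hz1
    _ = 2 / (A * κ ^ s) * ((n : ℝ) / (1 - r)) ^ s *
        (M / 2 * A * (κ * ((1 - r) / n)) ^ s) := by
        rw [Real.mul_rpow hκ0.le (by positivity)]
        have hne : A * κ ^ s ≠ 0 := by positivity
        calc M = M * 1 := (mul_one M).symm
          _ = M * (((n : ℝ) / (1 - r)) ^ s * ((1 - r) / n) ^ s) := by rw [hinv]
          _ = (A * κ ^ s) / (A * κ ^ s) *
              (M * (((n : ℝ) / (1 - r)) ^ s * ((1 - r) / n) ^ s)) := by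
              rw [div_self hne, one_mul]
          _ = _ := by ring
    _ ≤ _ := by gcongr
end
end

section
/- For every q ∈ (1, ∞] there exists a constant C > 0 (depending only on q) such that: for every n ≥ 1, every σ = (λ_1, …, λ_n) ∈ D^n with r = max_i |λ_i|, and every z ∈ ℂ with |z| ≤ 1, the reproducing kernel k_z^B of the model space K_B (B = B_σ) satisfies ‖k_z^B‖_{H^q} ≤ C · (n/(1−r))^{1−1/q} (with the convention 1 − 1/q = 1 for q = ∞). (Proposition 4.1, part (1).) -/
open Complex Metric

noncomputable section

/-- The elementary Blaschke factor `b_λ(z) = (λ - z)/(1 - conj(λ) z)`. -/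
def blaschkeF (l z : ℂ) : ℂ := (l - z) / (1 - (starRingEnd ℂ) l * z)

/-- The finite Blaschke product `B_σ = ∏ b_{λ_i}`. -/
def blaschkeProd {n : ℕ} (σ : Fin n → ℂ) (z : ℂ) : ℂ := ∏ i, blaschkeF (σ i) z

/-- The reproducing kernel of the model space `K_{B_σ}`:
`k_z^B(w) = (1 - conj(B(z)) B(w))/(1 - conj(z) w)`. -/
def modelKernel {n : ℕ} (σ : Fin n → ℂ) (z w : ℂ) : ℂ :=
  (1 - (starRingEnd ℂ) (blaschkeProd σ z) * blaschkeProd σ w) /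
    (1 - (starRingEnd ℂ) z * w)

/-- A Blaschke factor has modulus at most one on the closed disc. -/
lemma norm_blaschkeF_le_one {l z : ℂ} (hl : ‖l‖ < 1) (hz : ‖z‖ ≤ 1) : ‖blaschkeF l z‖ ≤ 1 := by
  rw [blaschkeF, norm_div]
  refine div_le_one_of_le₀ ?_ (norm_nonneg _)
  have hl' : ‖l‖ ^ 2 ≤ 1 := pow_le_one₀ (norm_nonneg _) hl.le
  have hz' : ‖z‖ ^ 2 ≤ 1 := pow_le_one₀ (norm_nonneg _) hz
  refine (sq_le_sq₀ (norm_nonneg _) (norm_nonneg _)).mp ?_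
  have h := mul_nonneg (sub_nonneg.2 hl') (sub_nonneg.2 hz')
  simp only [Complex.sq_norm, Complex.normSq_apply, sub_re, sub_im, mul_re, mul_im, one_re, one_im,
    conj_re, conj_im] at h ⊢
  linarith

lemma one_sub_norm_le_norm_one_sub_mul {a b : ℂ} (hb : ‖b‖ ≤ 1) :
    1 - ‖a‖ ≤ ‖1 - a * b‖ := by
  have h := norm_sub_norm_le (1 : ℂ) (a * b)
  rw [norm_one, norm_mul] at h
  nlinarith [norm_nonneg a]

lemma one_sub_mul_ne_zero {a b : ℂ} (ha : ‖a‖ < 1) (hb : ‖b‖ ≤ 1) : 1 - a * b ≠ 0 := by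
  have h := one_sub_norm_le_norm_one_sub_mul (a := a) hb
  exact norm_pos_iff.1 (by linarith)

lemma one_sub_conj_blaschkeF_mul {l z w : ℂ} (hl : ‖l‖ < 1) (hz : ‖z‖ ≤ 1) (hw : ‖w‖ ≤ 1) :
    1 - (starRingEnd ℂ) (blaschkeF l z) * blaschkeF l w =
      (1 - l * (starRingEnd ℂ) l) * (1 - (starRingEnd ℂ) z * w) /
        ((1 - l * (starRingEnd ℂ) z) * (1 - (starRingEnd ℂ) l * w)) := by
  have h1 : 1 - l * (starRingEnd ℂ) z ≠ 0 := one_sub_mul_ne_zero hl (by simpa using hz)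
  have h2 : 1 - (starRingEnd ℂ) l * w ≠ 0 := one_sub_mul_ne_zero (by simpa using hl) hw
  simp only [blaschkeF, map_div₀, map_sub, map_mul, map_one, Complex.conj_conj]
  rw [mul_comm l ((starRingEnd ℂ) z)] at h1 ⊢
  field_simp
  ring

lemma norm_one_sub_conj_blaschkeF_mul_le {l z w : ℂ} {r : ℝ} (hl : ‖l‖ ≤ r) (hr : r < 1)
    (hz : ‖z‖ ≤ 1) (hw : ‖w‖ ≤ 1) :
    ‖1 - (starRingEnd ℂ) (blaschkeF l z) * blaschkeF l w‖ ≤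
      2 / (1 - r) * ‖1 - (starRingEnd ℂ) z * w‖ := by
  have hl1 : ‖l‖ < 1 := hl.trans_lt hr
  have h1 : 1 - ‖l‖ ≤ ‖1 - l * (starRingEnd ℂ) z‖ :=
    one_sub_norm_le_norm_one_sub_mul (by simpa using hz)
  have h2 : 1 - ‖l‖ ≤ ‖1 - (starRingEnd ℂ) l * w‖ := by
    simpa using one_sub_norm_le_norm_one_sub_mul (a := (starRingEnd ℂ) l) hw
  have h3 : ‖1 - l * (starRingEnd ℂ) l‖ = 1 - ‖l‖ ^ 2 := by
    rw [Complex.mul_conj, Complex.normSq_eq_norm_sq, ← Complex.ofReal_one, ← Complex.ofReal_sub,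
      Complex.norm_real, Real.norm_of_nonneg]
    nlinarith [norm_nonneg l]
  rw [one_sub_conj_blaschkeF_mul hl1 hz hw, norm_div, norm_mul, norm_mul, h3, mul_div_right_comm]
  refine mul_le_mul_of_nonneg_right ?_ (norm_nonneg _)
  have h4 : 0 < 1 - ‖l‖ := by linarith
  calc (1 - ‖l‖ ^ 2) / (‖1 - l * (starRingEnd ℂ) z‖ * ‖1 - (starRingEnd ℂ) l * w‖)
      ≤ (1 - ‖l‖ ^ 2) / ((1 - ‖l‖) * (1 - ‖l‖)) := by
        have : 0 ≤ 1 - ‖l‖ ^ 2 := by nlinarith [norm_nonneg l]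
        gcongr
    _ = (1 + ‖l‖) / (1 - ‖l‖) := by field_simp; ring
    _ ≤ 2 / (1 - r) := by
        have : 0 < 1 - r := by linarith
        gcongr
        linarith

lemma norm_one_sub_prod_le {ι : Type*} (s : Finset ι) {c : ι → ℂ} (hc : ∀ i, ‖c i‖ ≤ 1) :
    ‖1 - ∏ i ∈ s, c i‖ ≤ ∑ i ∈ s, ‖1 - c i‖ := by
  classical
  induction s using Finset.induction_on with
  | empty => simp
  | insert a s ha ih =>
    rw [Finset.prod_insert ha, Finset.sum_insert ha]
    calc ‖1 - c a * ∏ i ∈ s, c i‖ = ‖(1 - c a) + c a * (1 - ∏ i ∈ s, c i)‖ := by ring_nf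
      _ ≤ ‖1 - c a‖ + ‖c a‖ * ‖1 - ∏ i ∈ s, c i‖ := by
        rw [← norm_mul]
        exact norm_add_le _ _
      _ ≤ _ := by
        gcongr
        exact (mul_le_of_le_one_left (norm_nonneg _) (hc a)).trans ih

section Kernel

variable {n : ℕ} {σ : Fin n → ℂ} {z w : ℂ} {r : ℝ}

lemma norm_blaschkeProd_le_one (hσ : ∀ i, ‖σ i‖ < 1) (hz : ‖z‖ ≤ 1) :
    ‖blaschkeProd σ z‖ ≤ 1 := by
  rw [blaschkeProd, norm_prod]
  exact Finset.prod_le_one (fun _ _ => norm_nonneg _) fun i _ => norm_blaschkeF_le_one (hσ i) hz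

lemma norm_modelKernel_le (hσ : ∀ i, ‖σ i‖ ≤ r) (hr : r < 1) (hz : ‖z‖ ≤ 1) (hw : ‖w‖ < 1) :
    ‖modelKernel σ z w‖ ≤ 2 * ((n : ℝ) / (1 - r)) := by
  have hne : 1 - (starRingEnd ℂ) z * w ≠ 0 := by
    rw [mul_comm]
    exact one_sub_mul_ne_zero hw (by simpa using hz)
  rw [modelKernel, norm_div, div_le_iff₀ (norm_pos_iff.2 hne)]
  have hprod : (starRingEnd ℂ) (blaschkeProd σ z) * blaschkeProd σ w =
      ∏ i, (starRingEnd ℂ) (blaschkeF (σ i) z) * blaschkeF (σ i) w := by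
    rw [blaschkeProd, blaschkeProd, map_prod, Finset.prod_mul_distrib]
  rw [hprod]
  refine (norm_one_sub_prod_le _ fun i => ?_).trans ?_
  · rw [norm_mul, Complex.norm_conj]
    have hi := (hσ i).trans_lt hr
    exact mul_le_one₀ (norm_blaschkeF_le_one hi hz) (norm_nonneg _)
      (norm_blaschkeF_le_one hi hw.le)
  · refine (Finset.sum_le_sum fun i _ =>
      norm_one_sub_conj_blaschkeF_mul_le (hσ i) hr hz hw.le).trans (le_of_eq ?_)
    rw [Finset.sum_const, Finset.card_univ, Fintype.card_fin, nsmul_eq_mul]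
    ring

lemma norm_modelKernel_mul_le (hσ : ∀ i, ‖σ i‖ < 1) (hz : ‖z‖ ≤ 1) (hw : ‖w‖ < 1) :
    ‖modelKernel σ z w‖ * ‖1 - (starRingEnd ℂ) z * w‖ ≤ 2 := by
  have hne : 1 - (starRingEnd ℂ) z * w ≠ 0 := by
    rw [mul_comm]
    exact one_sub_mul_ne_zero hw (by simpa using hz)
  rw [← norm_mul, modelKernel, div_mul_cancel₀ _ hne]
  refine (norm_sub_le _ _).trans ?_
  rw [norm_one, norm_mul, Complex.norm_conj]
  have := mul_le_one₀ (norm_blaschkeProd_le_one hσ hz) (norm_nonneg _)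
    (norm_blaschkeProd_le_one hσ hw.le)
  linarith

lemma continuousOn_modelKernel (hσ : ∀ i, ‖σ i‖ < 1) (hz : ‖z‖ ≤ 1) :
    ContinuousOn (modelKernel σ z) (ball 0 1) := by
  have hB : ContinuousOn (blaschkeProd σ) (ball 0 1) := by
    refine continuousOn_finsetProd _ fun i _ => ?_
    refine ContinuousOn.div (by fun_prop) (by fun_prop) fun w hw => ?_
    exact one_sub_mul_ne_zero (by simpa using hσ i) (mem_ball_zero_iff.1 hw).le
  refine ContinuousOn.div (by fun_prop) (by fun_prop) fun w hw => ?_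
  rw [mul_comm]
  exact one_sub_mul_ne_zero (mem_ball_zero_iff.1 hw) (by simpa using hz)

end Kernel

lemma abs_div_pi_le_norm_one_sub_mul_exp {s t : ℝ} (hs : 0 ≤ s) (ht : |t| ≤ Real.pi) :
    |t| / Real.pi ≤ ‖1 - (s : ℂ) * Complex.exp (t * Complex.I)‖ := by
  have hpi := Real.pi_pos
  refine (sq_le_sq₀ (by positivity) (norm_nonneg _)).mp ?_
  have hcos := Real.cos_le_one_sub_mul_cos_sq ht
  have hv : t ^ 2 / Real.pi ^ 2 ≤ 1 := by
    rw [div_le_one (by positivity)]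
    exact sq_le_sq' (abs_le.1 ht).1 (abs_le.1 ht).2
  have hv0 : 0 ≤ t ^ 2 / Real.pi ^ 2 := by positivity
  have hc : Real.cos t ≤ 1 - 2 * (t ^ 2 / Real.pi ^ 2) := hcos.trans (le_of_eq (by ring))
  have hsq : ‖1 - (s : ℂ) * Complex.exp (t * Complex.I)‖ ^ 2 =
      (1 - s) ^ 2 + 2 * s * (1 - Real.cos t) := by
    rw [Complex.sq_norm, Complex.normSq_apply]
    simp only [sub_re, sub_im, one_re, one_im, re_ofReal_mul, im_ofReal_mul,
      Complex.exp_ofReal_mul_I_re, Complex.exp_ofReal_mul_I_im]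
    linear_combination s ^ 2 * Real.sin_sq_add_cos_sq t
  rw [hsq, div_pow, sq_abs]
  nlinarith [mul_nonneg hs hv0, mul_le_mul_of_nonneg_left hc hs, sq_nonneg (1 - s),
    mul_nonneg hv0 hs, mul_nonneg (sub_nonneg.2 hv) (sq_nonneg (1 - s)),
    mul_nonneg hv0 (sq_nonneg s)]

lemma integral_add_mul_rpow_neg_le {q N a T : ℝ} (hq : 1 < q) (hN : 0 < N) (ha : 0 < a)
    (hT : 0 ≤ T) :
    ∫ t in (0 : ℝ)..T, (a + N * t) ^ (-q) ≤ N⁻¹ * (a ^ (1 - q) / (q - 1)) := by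
  rw [intervalIntegral.integral_comp_add_mul (fun x : ℝ => x ^ (-q)) hN.ne', smul_eq_mul]
  refine mul_le_mul_of_nonneg_left ?_ (by positivity)
  have hT' : 0 < a + N * T := by positivity
  rw [mul_zero, add_zero, integral_rpow]
  · have h : 0 ≤ (a + N * T) ^ (1 - q) := by positivity
    rw [← neg_div_neg_eq, show -q + 1 = 1 - q by ring, neg_sub, neg_sub]
    have : 0 < q - 1 := by linarith
    gcongr
    linarith
  · refine Or.inr ⟨by linarith, fun h => ?_⟩
    rw [Set.mem_uIcc] at h
    rcases h with h | h <;> linarith [h.1]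

/-- Integral bound for a periodic function dominated by `c / (π + N |t|)` about a point `φ`. -/
lemma integral_rpow_le_of_periodic {f : ℝ → ℝ} (hf : Continuous f) (hf0 : ∀ θ, 0 ≤ f θ)
    (hper : Function.Periodic f (2 * Real.pi)) {q N c φ : ℝ} (hq : 1 < q) (hN : 0 < N)
    (hc : 0 ≤ c)
    (hbd : ∀ t, |t| ≤ Real.pi → f (φ + t) * (Real.pi + N * |t|) ≤ c) :
    ∫ θ in (0 : ℝ)..(2 * Real.pi), f θ ^ q ≤
      2 * (c ^ q * (N⁻¹ * (Real.pi ^ (1 - q) / (q - 1)))) := by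
  have hpi := Real.pi_pos
  have hfq : Continuous fun θ => f θ ^ q := hf.rpow_const fun _ => Or.inr (by linarith)
  have hperq : Function.Periodic (fun θ => f θ ^ q) (2 * Real.pi) := fun θ => by
    simp only [hper θ]
  have hshift : ∫ θ in (0 : ℝ)..(2 * Real.pi), f θ ^ q =
      ∫ t in (-Real.pi)..Real.pi, f (φ + t) ^ q := by
    rw [intervalIntegral.integral_comp_add_left (fun θ => f θ ^ q)]
    have := hperq.intervalIntegral_add_eq 0 (φ + -Real.pi)
    rw [zero_add] at this
    rw [this]
    congr 1
    ring
  have hcont : Continuous fun t => f (φ + t) ^ q := hfq.comp (by fun_prop)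
  have hsplit : ∫ t in (-Real.pi)..Real.pi, f (φ + t) ^ q =
      (∫ t in (0 : ℝ)..Real.pi, f (φ + -t) ^ q) + ∫ t in (0 : ℝ)..Real.pi, f (φ + t) ^ q := by
    rw [intervalIntegral.integral_comp_neg (fun t => f (φ + t) ^ q), neg_zero]
    exact (intervalIntegral.integral_add_adjacent_intervals (hcont.intervalIntegrable _ _)
      (hcont.intervalIntegrable _ _)).symm
  have hhalf : ∀ g : ℝ → ℝ, Continuous g → (∀ t, 0 ≤ g t) →
      (∀ t, 0 ≤ t → t ≤ Real.pi → g t * (Real.pi + N * t) ≤ c) →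
      ∫ t in (0 : ℝ)..Real.pi, g t ^ q ≤ c ^ q * (N⁻¹ * (Real.pi ^ (1 - q) / (q - 1))) := by
    intro g hg hg0 hgc
    have hpos : ∀ t ∈ Set.Icc 0 Real.pi, 0 < Real.pi + N * t := fun t ht => by
      have := mul_nonneg hN.le ht.1
      linarith
    calc ∫ t in (0 : ℝ)..Real.pi, g t ^ q
        ≤ ∫ t in (0 : ℝ)..Real.pi, c ^ q * (Real.pi + N * t) ^ (-q) := by
          refine intervalIntegral.integral_mono_on hpi.le
            ((hg.rpow_const fun _ => Or.inr (by linarith)).intervalIntegrable _ _) ?_ ?_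
          · refine ContinuousOn.intervalIntegrable ?_
            rw [Set.uIcc_of_le hpi.le]
            exact continuousOn_const.mul (ContinuousOn.rpow_const (by fun_prop)
              fun t ht => Or.inl (hpos t ht).ne')
          · intro t ht
            have hp := hpos t ht
            rw [Real.rpow_neg hp.le, ← div_eq_mul_inv, ← Real.div_rpow hc hp.le]
            exact Real.rpow_le_rpow (hg0 t) ((le_div_iff₀ hp).2 (hgc t ht.1 ht.2)) (by linarith)
      _ ≤ _ := by
          rw [intervalIntegral.integral_const_mul]
          exact mul_le_mul_of_nonneg_left (integral_add_mul_rpow_neg_le hq hN hpi hpi.le)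
            (by positivity)
  rw [hshift, hsplit, two_mul]
  refine add_le_add (hhalf _ (hf.comp (by fun_prop)) (fun _ => hf0 _) fun t h0 h1 => ?_)
    (hhalf _ (hf.comp (by fun_prop)) (fun _ => hf0 _) fun t h0 h1 => ?_)
  · simpa [abs_of_nonneg h0] using hbd (-t) (by rwa [abs_neg, abs_of_nonneg h0])
  · simpa [abs_of_nonneg h0] using hbd t (by rwa [abs_of_nonneg h0])

/-- Proposition 4.1, part (1): for `q ∈ (1, ∞]` one has
`‖k_z^B‖_{H^q} ≤ C (n/(1-r))^{1-1/q}` (with exponent `1` for `q = ∞`),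
where `r = max_i |λ_i|` and `|z| ≤ 1`. -/
theorem kernel_Hq_norm_estimate :
    -- the case `q ∈ (1, ∞)`
    (∀ q : ℝ, 1 < q →
      ∃ C : ℝ, 0 < C ∧
        ∀ (n : ℕ), 1 ≤ n → ∀ σ : Fin n → ℂ,
        ∀ r : ℝ, (∀ i, ‖σ i‖ ≤ r) → r < 1 →
        ∀ z : ℂ, ‖z‖ ≤ 1 →
        ∀ ρ : ℝ, 0 < ρ → ρ < 1 →
          ((2 * Real.pi)⁻¹ * ∫ θ in (0:ℝ)..(2 * Real.pi),
              ‖modelKernel σ z ((ρ : ℂ) * Complex.exp ((θ : ℂ) * Complex.I))‖ ^ q)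
              ^ (1 / q)
            ≤ C * ((n : ℝ) / (1 - r)) ^ (1 - 1 / q)) ∧
    -- the case `q = ∞`
    (∃ C : ℝ, 0 < C ∧
      ∀ (n : ℕ), 1 ≤ n → ∀ σ : Fin n → ℂ,
      ∀ r : ℝ, (∀ i, ‖σ i‖ ≤ r) → r < 1 →
      ∀ z : ℂ, ‖z‖ ≤ 1 →
      ∀ w ∈ ball (0:ℂ) 1,
        ‖modelKernel σ z w‖ ≤ C * ((n : ℝ) / (1 - r))) := by
  refine ⟨fun q hq => ?_, 2, two_pos, fun n _ σ r hσ hr z hz w hw =>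
    norm_modelKernel_le hσ hr hz (mem_ball_zero_iff.1 hw)⟩
  have hpi := Real.pi_pos
  have hq1 : 0 < q - 1 := by linarith
  set K : ℝ := (2 * Real.pi)⁻¹ * (2 * ((4 * Real.pi) ^ q * (Real.pi ^ (1 - q) / (q - 1)))) with hK
  have hKpos : 0 < K := by positivity
  refine ⟨K ^ (1 / q), by positivity, fun n hn σ r hσ hr z hz ρ hρ0 hρ1 => ?_⟩
  have hσ1 : ∀ i, ‖σ i‖ < 1 := fun i => (hσ i).trans_lt hr
  have hn0 : (0 : ℝ) < n := by exact_mod_cast hn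
  have hr0 : 0 < 1 - r := by linarith
  set N : ℝ := (n : ℝ) / (1 - r) with hN
  have hNpos : 0 < N := by positivity
  set w : ℝ → ℂ := fun θ => (ρ : ℂ) * Complex.exp ((θ : ℂ) * Complex.I) with hw
  have hwnorm : ∀ θ, ‖w θ‖ < 1 := fun θ => by
    rw [hw, norm_mul, Complex.norm_exp_ofReal_mul_I, mul_one, Complex.norm_real,
      Real.norm_of_nonneg hρ0.le]
    exact hρ1
  have hwcont : Continuous w := by fun_prop
  have hwper : Function.Periodic w (2 * Real.pi) := fun θ => by
    simp only [hw]
    push_cast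
    rw [add_mul, Complex.exp_periodic]
  have hfcont : Continuous fun θ => ‖modelKernel σ z (w θ)‖ :=
    ((continuousOn_modelKernel hσ1 hz).comp_continuous hwcont
      fun θ => mem_ball_zero_iff.2 (hwnorm θ)).norm
  set a : ℂ := (starRingEnd ℂ) z * ρ with ha
  have hrot : ∀ t : ℝ, (starRingEnd ℂ) z * w (-a.arg + t) =
      (‖a‖ : ℂ) * Complex.exp (t * Complex.I) := fun t => by
    simp only [hw]
    rw [← mul_assoc, ← ha]
    calc a * Complex.exp (((-a.arg + t : ℝ) : ℂ) * Complex.I)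
        = (‖a‖ * Complex.exp (a.arg * Complex.I)) *
            Complex.exp (((-a.arg + t : ℝ) : ℂ) * Complex.I) := by
          rw [Complex.norm_mul_exp_arg_mul_I]
      _ = _ := by
          rw [mul_assoc, ← Complex.exp_add]
          push_cast
          ring_nf
  have hint := integral_rpow_le_of_periodic (f := fun θ => ‖modelKernel σ z (w θ)‖)
    (c := 4 * Real.pi * N) (φ := -a.arg) hfcont (fun _ => norm_nonneg _)
    (fun θ => by simp only [hwper θ]) hq hNpos (by positivity) (fun t ht => by
      have h1 := norm_modelKernel_le hσ hr hz (hwnorm (-a.arg + t))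
      have h2 := norm_modelKernel_mul_le hσ1 hz (hwnorm (-a.arg + t))
      have h3 := abs_div_pi_le_norm_one_sub_mul_exp (norm_nonneg a) ht
      rw [hrot] at h2
      have h4 := (mul_le_mul_of_nonneg_left h3
        (norm_nonneg (modelKernel σ z (w (-a.arg + t))))).trans h2
      rw [mul_div_assoc', div_le_iff₀ hpi] at h4
      calc ‖modelKernel σ z (w (-a.arg + t))‖ * (Real.pi + N * |t|)
          = ‖modelKernel σ z (w (-a.arg + t))‖ * Real.pi +
              N * (‖modelKernel σ z (w (-a.arg + t))‖ * |t|) := by ring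
        _ ≤ 2 * N * Real.pi + N * (2 * Real.pi) := by gcongr
        _ = 4 * Real.pi * N := by ring)
  have hmean : (2 * Real.pi)⁻¹ * ∫ θ in (0 : ℝ)..(2 * Real.pi), ‖modelKernel σ z (w θ)‖ ^ q ≤
      K * N ^ (q - 1) := by
    refine (mul_le_mul_of_nonneg_left hint (by positivity)).trans (le_of_eq ?_)
    rw [Real.mul_rpow (by positivity) hNpos.le, Real.rpow_sub_one hNpos.ne', hK]
    ring
  calc _ ≤ (K * N ^ (q - 1)) ^ (1 / q) := by
        refine Real.rpow_le_rpow (mul_nonneg (by positivity) ?_) hmean (by positivity)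
        exact intervalIntegral.integral_nonneg (by positivity) fun _ _ => by positivity
    _ = K ^ (1 / q) * N ^ (1 - 1 / q) := by
        rw [Real.mul_rpow hKpos.le (by positivity), ← Real.rpow_mul hNpos.le]
        congr 2
        field_simp
end
end

section
/- For every p ∈ [1, ∞) there exists a constant C_p > 0 (depending only on p) such that: for every n ≥ 1, every r ∈ [0, 1), every complex n×n matrix T with operator norm at most 1 (with respect to the Euclidean norm on ℂ^n) all of whose eigenvalues λ satisfy |λ| ≤ r, and every holomorphic function f on D with Taylor expansion f(z) = Σ_{k≥0} a_k z^k and ‖f‖_{H^p} ≤ 1, the series f(T) = Σ_{k≥0} a_k T^k converges in the n×n matrices and ‖f(T)‖ ≤ C_p · (n/(1−r))^{1/p}. (Corollary 2.2, Hardy case, upper bound.) -/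
open Complex Metric

noncomputable section

/-! ### Eigenvalue bounds on traces and powers -/

section Trace

variable {E : Type*} [NormedAddCommGroup E] [InnerProductSpace ℂ E] [FiniteDimensional ℂ E]

lemma spectrum_toLinearMap (T : E →L[ℂ] E) :
    spectrum ℂ (T.toLinearMap : Module.End ℂ E) = spectrum ℂ T :=
  (AlgEquiv.spectrum_eq (Module.End.toContinuousLinearMap E) T.toLinearMap).symm

lemma norm_trace_le_of_spectrum (T : E →L[ℂ] E) {r : ℝ} (h : ∀ μ ∈ spectrum ℂ T, ‖μ‖ ≤ r) :
    ‖LinearMap.trace ℂ E T.toLinearMap‖ ≤ Module.finrank ℂ E * r := by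
  have hs : (LinearMap.charpoly T.toLinearMap).Splits := IsAlgClosed.splits _
  rw [Module.End.trace_eq_sum_roots_charpoly_of_splits hs]
  refine (norm_multiset_sum_le _).trans ((Multiset.sum_le_card_nsmul _ r ?_).trans_eq ?_)
  · simp only [Multiset.mem_map]
    rintro _ ⟨μ, hμ, rfl⟩
    refine h μ ?_
    rw [← spectrum_toLinearMap, Module.End.mem_spectrum_iff_isRoot_charpoly]
    exact Polynomial.isRoot_of_mem_roots hμ
  · rw [Multiset.card_map, ← hs.natDegree_eq_card_roots, LinearMap.charpoly_natDegree,
      nsmul_eq_mul]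

lemma norm_trace_pow_le_of_spectrum [Nontrivial E] (T : E →L[ℂ] E) {r : ℝ}
    (h : ∀ μ ∈ spectrum ℂ T, ‖μ‖ ≤ r) (k : ℕ) :
    ‖LinearMap.trace ℂ E (T ^ k).toLinearMap‖ ≤ Module.finrank ℂ E * r ^ k := by
  refine norm_trace_le_of_spectrum _ fun μ hμ => ?_
  rw [spectrum.map_pow] at hμ
  obtain ⟨ν, hν, rfl⟩ := hμ
  simpa using pow_le_pow_left₀ (norm_nonneg _) (h ν hν) k

end Trace

lemma eventually_norm_pow_le_of_spectrum {A : Type*} [NormedRing A] [NormedAlgebra ℂ A]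
    [CompleteSpace A] (T : A) {r s : ℝ} (h : ∀ μ ∈ spectrum ℂ T, ‖μ‖ ≤ r) (hr : 0 ≤ r)
    (hrs : r < s) : ∀ᶠ k : ℕ in Filter.atTop, ‖T ^ k‖ ≤ s ^ k := by
  have hs : 0 < s := hr.trans_lt hrs
  have h1 : spectralRadius ℂ T < ENNReal.ofReal s := by
    refine lt_of_le_of_lt (b := ENNReal.ofReal r) (iSup₂_le fun μ hμ => ?_) ?_
    · rw [← enorm_eq_nnnorm, ← ofReal_norm]
      exact ENNReal.ofReal_le_ofReal (h μ hμ)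
    · exact (ENNReal.ofReal_lt_ofReal_iff hs).2 hrs
  filter_upwards [(spectrum.pow_norm_pow_one_div_tendsto_nhds_spectralRadius T).eventually_lt_const
    h1, Filter.eventually_gt_atTop 0] with k hk hk0
  rw [ENNReal.ofReal_lt_ofReal_iff hs, one_div] at hk
  have := pow_le_pow_left₀ (by positivity) hk.le k
  rwa [Real.rpow_inv_natCast_pow (norm_nonneg _) hk0.ne'] at this

/-! ### The operator Poisson kernel -/

section Poisson

variable {E : Type*} [NormedAddCommGroup E] [InnerProductSpace ℂ E] [FiniteDimensional ℂ E]

/-- The Poisson kernel `Re ((1 + S)(1 - S)⁻¹)` of an operator `S`. -/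
def poissonOp (S : E →L[ℂ] E) : E →L[ℂ] E :=
  ∑' k : ℕ, S ^ k + ContinuousLinearMap.adjoint (∑' k : ℕ, S ^ k) - 1

lemma inner_poissonOp (S : E →L[ℂ] E) (x y : E) :
    inner ℂ y (poissonOp S x) =
      inner ℂ y ((∑' k : ℕ, S ^ k) x) + inner ℂ ((∑' k : ℕ, S ^ k) y) x - inner ℂ y x := by
  simp [poissonOp, ContinuousLinearMap.adjoint_inner_right]

lemma inner_poissonOp_swap (S : E →L[ℂ] E) (x y : E) :
    inner ℂ y (poissonOp S x) = (starRingEnd ℂ) (inner ℂ x (poissonOp S y)) := by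
  simp only [inner_poissonOp, map_sub, map_add, inner_conj_symm]
  ring

lemma re_inner_poissonOp_nonneg {S : E →L[ℂ] E} (hS : ‖S‖ ≤ 1)
    (hsum : Summable fun k : ℕ => S ^ k) (x : E) : 0 ≤ (inner ℂ x (poissonOp S x)).re := by
  rw [inner_poissonOp]
  set w := (∑' k : ℕ, S ^ k) x with hw
  have hx : x = w - S w := by
    have h1 : (1 - S) * ∑' k : ℕ, S ^ k = 1 := by
      rw [sub_mul, one_mul, ← hsum.tsum_mul_left, hsum.tsum_eq_zero_add]
      simp [pow_succ']
    have := congrArg (fun A : E →L[ℂ] E => A x) h1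
    simpa using this.symm
  have h2 : ‖S w‖ ≤ ‖w‖ := by simpa using S.le_of_opNorm_le hS w
  have h3 : ‖S w‖ ^ 2 ≤ ‖w‖ ^ 2 := by gcongr
  have e1 : (inner ℂ w w : ℂ).re = ‖w‖ ^ 2 := inner_self_eq_norm_sq (𝕜 := ℂ) w
  have e2 : (inner ℂ (S w) (S w) : ℂ).re = ‖S w‖ ^ 2 := inner_self_eq_norm_sq (𝕜 := ℂ) (S w)
  rw [hx]
  simp only [inner_sub_left, inner_sub_right, Complex.add_re, Complex.sub_re]
  linarith

lemma norm_inner_poissonOp_le {S : E →L[ℂ] E} (hS : ‖S‖ ≤ 1)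
    (hsum : Summable fun k : ℕ => S ^ k) (x y : E) :
    ‖inner ℂ y (poissonOp S x)‖ ≤
      ((inner ℂ x (poissonOp S x)).re + (inner ℂ y (poissonOp S y)).re) / 2 := by
  obtain ⟨c, hc, hc'⟩ : ∃ c : ℂ, ‖c‖ = 1 ∧
      c * inner ℂ y (poissonOp S x) = (‖inner ℂ y (poissonOp S x)‖ : ℂ) := by
    obtain ⟨c, hc, h⟩ := RCLike.exists_norm_eq_mul_self (inner ℂ y (poissonOp S x))
    exact ⟨c, hc, h.symm⟩
  have h := re_inner_poissonOp_nonneg hS hsum (c • x - y)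
  have hcc : (starRingEnd ℂ) c * c = 1 := by
    rw [← Complex.normSq_eq_conj_mul_self, Complex.normSq_eq_norm_sq, hc]; simp
  have e : inner ℂ (c • x - y) (poissonOp S (c • x - y)) =
      inner ℂ x (poissonOp S x) + inner ℂ y (poissonOp S y)
        - (c * inner ℂ y (poissonOp S x)
          + (starRingEnd ℂ) (c * inner ℂ y (poissonOp S x))) := by
    simp only [map_sub, map_smul, inner_sub_left, inner_sub_right, inner_smul_left,
      inner_smul_right, map_mul, ← inner_poissonOp_swap S y x]
    linear_combination inner ℂ x (poissonOp S x) * hcc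
  rw [e, hc', Complex.conj_ofReal] at h
  simp only [Complex.add_re, Complex.sub_re, Complex.ofReal_re] at h
  linarith

lemma re_inner_poissonOp_le_trace {S : E →L[ℂ] E} (hS : ‖S‖ ≤ 1)
    (hsum : Summable fun k : ℕ => S ^ k) {x : E} (hx : ‖x‖ = 1) :
    (inner ℂ x (poissonOp S x)).re ≤ (LinearMap.trace ℂ E (poissonOp S).toLinearMap).re := by
  have hon : Orthonormal ℂ ((↑) : ({x} : Set E) → E) :=
    ⟨fun i => by rw [Set.mem_singleton_iff.1 i.2, hx],
      fun i j hij => absurd (Subsingleton.elim i j) hij⟩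
  obtain ⟨u, b, hu, hb⟩ := hon.exists_orthonormalBasis_extension
  rw [LinearMap.trace_eq_sum_inner _ b, Complex.re_sum]
  have hxu : x ∈ u := hu rfl
  have := Finset.single_le_sum (f := fun i => (inner ℂ (b i) (poissonOp S (b i))).re)
    (fun i _ => re_inner_poissonOp_nonneg hS hsum (b i)) (Finset.mem_univ ⟨x, hxu⟩)
  simpa [hb] using this

lemma trace_poissonOp_re_le [Nontrivial E] {S : E →L[ℂ] E} (hsum : Summable fun k : ℕ => S ^ k)
    {r : ℝ} (hr : 0 ≤ r) (hr1 : r < 1) (h : ∀ μ ∈ spectrum ℂ S, ‖μ‖ ≤ r) :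
    (LinearMap.trace ℂ E (poissonOp S).toLinearMap).re ≤ 2 * (Module.finrank ℂ E / (1 - r)) := by
  let tr : (E →L[ℂ] E) →L[ℂ] ℂ := LinearMap.toContinuousLinearMap
    ((LinearMap.trace ℂ E).comp (ContinuousLinearMap.coeLM ℂ))
  have htr : ∀ A : E →L[ℂ] E, tr A = LinearMap.trace ℂ E A.toLinearMap := fun A => rfl
  have hadj : ∀ A : E →L[ℂ] E, (tr (ContinuousLinearMap.adjoint A)).re = (tr A).re := by
    intro A
    rw [htr, htr, LinearMap.trace_eq_sum_inner _ (stdOrthonormalBasis ℂ E),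
      LinearMap.trace_eq_sum_inner _ (stdOrthonormalBasis ℂ E), Complex.re_sum, Complex.re_sum]
    refine Finset.sum_congr rfl fun i _ => ?_
    simp only [ContinuousLinearMap.coe_coe, ContinuousLinearMap.adjoint_inner_right]
    exact inner_re_symm (𝕜 := ℂ) _ _
  have hone : tr 1 = Module.finrank ℂ E := by
    rw [htr]; exact LinearMap.trace_one ℂ E
  have hgeom := (hasSum_geometric_of_lt_one hr hr1).mul_left (Module.finrank ℂ E : ℝ)
  have hR : ‖tr (∑' k : ℕ, S ^ k)‖ ≤ Module.finrank ℂ E / (1 - r) := by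
    rw [tr.map_tsum hsum, div_eq_mul_inv]
    exact tsum_of_norm_bounded hgeom fun k => norm_trace_pow_le_of_spectrum S h k
  rw [← htr, poissonOp, map_sub, map_add, Complex.sub_re, Complex.add_re, hadj, hone,
    Complex.natCast_re]
  have := (Complex.re_le_norm _).trans hR
  have : (0 : ℝ) ≤ Module.finrank ℂ E := Nat.cast_nonneg _
  linarith

end Poisson

/-! ### Fourier series on the circle -/

section Fourier

lemma norm_mul_exp_int_mul (z : ℂ) (m : ℤ) (θ : ℝ) : ‖z * exp ((m : ℂ) * (θ * I))‖ = ‖z‖ := by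
  have : (m : ℂ) * (θ * I) = ((m * θ : ℝ) : ℂ) * I := by push_cast; ring
  rw [norm_mul, this, Complex.norm_exp_ofReal_mul_I, mul_one]

lemma integral_tsum_exp {ι : Type*} [Countable ι] {c : ι → ℂ} (hc : Summable fun i => ‖c i‖)
    (m : ι → ℤ) :
    ∫ θ in (0 : ℝ)..(2 * Real.pi), ∑' i, c i * exp ((m i : ℂ) * (θ * I)) =
      2 * Real.pi * ∑' i, if m i = 0 then c i else 0 := by
  have key := intervalIntegral.hasSum_integral_of_dominated_convergence
    (μ := MeasureTheory.volume) (a := 0) (b := 2 * Real.pi)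
    (F := fun i (θ : ℝ) => c i * exp ((m i : ℂ) * (θ * I)))
    (f := fun θ => ∑' i, c i * exp ((m i : ℂ) * (θ * I)))
    (fun i _ => ‖c i‖)
    (fun i => (by fun_prop : Continuous _).aestronglyMeasurable)
    (fun i => Filter.Eventually.of_forall fun θ _ => (norm_mul_exp_int_mul _ _ _).le)
    (Filter.Eventually.of_forall fun θ _ => hc)
    (intervalIntegrable_const)
    (Filter.Eventually.of_forall fun θ _ =>
      (Summable.of_norm (by simpa only [norm_mul_exp_int_mul] using hc)).hasSum)
  rw [← key.tsum_eq, ← tsum_mul_left]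
  refine tsum_congr fun i => ?_
  rw [intervalIntegral.integral_const_mul]
  split_ifs with h
  · simp [h]; ring
  · have h0 : (m i : ℂ) * I ≠ 0 := mul_ne_zero (by exact_mod_cast h) I_ne_zero
    have : ∀ θ : ℝ, (m i : ℂ) * (θ * I) = (m i * I) * θ := fun θ => by ring
    simp only [this, integral_exp_mul_complex h0]
    have h1 : exp ((m i * I) * (2 * Real.pi : ℝ)) = 1 := by
      rw [← Complex.exp_int_mul_two_pi_mul_I (m i)]; push_cast; ring_nf
    rw [h1]; simp

lemma integral_tsum_exp_mul {a c : ℕ → ℂ} (ha : Summable fun k => ‖a k‖)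
    (hc : Summable fun k => ‖c k‖) (ε : ℤ) :
    ∫ θ in (0 : ℝ)..(2 * Real.pi), (∑' k : ℕ, a k * exp (((k : ℤ) : ℂ) * (θ * I))) *
        ∑' k : ℕ, c k * exp (((ε * k : ℤ) : ℂ) * (θ * I)) =
      2 * Real.pi * ∑' k : ℕ, ∑' j : ℕ, if (k : ℤ) + ε * j = 0 then a k * c j else 0 := by
  have hac : Summable fun p : ℕ × ℕ => ‖a p.1 * c p.2‖ := ha.mul_norm hc
  have h := integral_tsum_exp hac (fun p => (p.1 : ℤ) + ε * p.2)
  rw [Summable.tsum_prod] at h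
  · rw [← h]
    refine intervalIntegral.integral_congr fun θ _ => ?_
    rw [tsum_mul_tsum_of_summable_norm (by simpa only [norm_mul_exp_int_mul] using ha)
      (by simpa only [norm_mul_exp_int_mul] using hc)]
    refine tsum_congr fun p => ?_
    rw [Int.cast_add, add_mul, Complex.exp_add]
    ring
  · refine Summable.of_norm_bounded hac fun p => ?_
    split_ifs
    · rfl
    · simpa using mul_nonneg (norm_nonneg (a p.1)) (norm_nonneg (c p.2))

lemma continuous_tsum_exp {c : ℕ → ℂ} (hc : Summable fun k => ‖c k‖) (ε : ℤ) :
    Continuous fun θ : ℝ => ∑' k : ℕ, c k * exp (((ε * k : ℤ) : ℂ) * (θ * I)) := by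
  refine continuous_tsum (fun k => by fun_prop) hc fun k θ => (norm_mul_exp_int_mul _ _ _).le

end Fourier

/-! ### The functional calculus as an integral against the Poisson kernel -/

section Calculus

variable {E : Type*} [NormedAddCommGroup E] [InnerProductSpace ℂ E]

lemma norm_exp_neg_ofReal_mul_I (θ : ℝ) : ‖exp (-(θ * I))‖ = 1 := by
  rw [← neg_mul, ← Complex.ofReal_neg, Complex.norm_exp_ofReal_mul_I]

lemma norm_exp_smul_pow (T : E →L[ℂ] E) (θ : ℝ) (k : ℕ) :
    ‖(exp (-(θ * I)) • T) ^ k‖ = ‖T ^ k‖ := by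
  rw [smul_pow, norm_smul, norm_pow, norm_exp_neg_ofReal_mul_I, one_pow, one_mul]

lemma summable_norm_inner_pow {T : E →L[ℂ] E} (hT : Summable fun k : ℕ => ‖T ^ k‖) (x y : E) :
    Summable fun k : ℕ => ‖(inner ℂ y ((T ^ k) x) : ℂ)‖ := by
  refine Summable.of_nonneg_of_le (fun _ => norm_nonneg _) (fun k => ?_)
    (hT.mul_left (‖y‖ * ‖x‖))
  calc ‖(inner ℂ y ((T ^ k) x) : ℂ)‖ ≤ ‖y‖ * ‖(T ^ k) x‖ := norm_inner_le_norm _ _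
    _ ≤ ‖y‖ * (‖T ^ k‖ * ‖x‖) := by gcongr; exact (T ^ k).le_opNorm x
    _ = ‖y‖ * ‖x‖ * ‖T ^ k‖ := by ring

lemma summable_norm_inner_pow' {T : E →L[ℂ] E} (hT : Summable fun k : ℕ => ‖T ^ k‖) (x y : E) :
    Summable fun k : ℕ => ‖(inner ℂ ((T ^ k) y) x : ℂ)‖ := by
  simpa only [norm_inner_symm] using summable_norm_inner_pow hT y x

lemma inner_tsum_apply {A : ℕ → E →L[ℂ] E} (hA : Summable A) (x y : E) :
    inner ℂ y ((∑' k, A k) x) = ∑' k, (inner ℂ y (A k x) : ℂ) :=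
  ((innerSL ℂ y).comp (ContinuousLinearMap.apply ℂ E x)).map_tsum hA

variable [FiniteDimensional ℂ E]

lemma inner_tsum_exp_smul_pow {T : E →L[ℂ] E} (hT : Summable fun k : ℕ => ‖T ^ k‖) (θ : ℝ)
    (x y : E) : inner ℂ y ((∑' k : ℕ, (exp (-(θ * I)) • T) ^ k) x) =
      ∑' k : ℕ, (inner ℂ y ((T ^ k) x) : ℂ) * exp ((((-1) * k : ℤ) : ℂ) * (θ * I)) := by
  rw [inner_tsum_apply (Summable.of_norm (by simpa only [norm_exp_smul_pow] using hT))]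
  refine tsum_congr fun k => ?_
  rw [smul_pow, _root_.smul_apply, inner_smul_right, ← Complex.exp_nat_mul, mul_comm]
  congr 2
  push_cast; ring

lemma inner_poissonOp_exp_smul {T : E →L[ℂ] E} (hT : Summable fun k : ℕ => ‖T ^ k‖) (θ : ℝ)
    (x y : E) : inner ℂ y (poissonOp (exp (-(θ * I)) • T) x) =
      ∑' k : ℕ, (inner ℂ y ((T ^ k) x) : ℂ) * exp ((((-1) * k : ℤ) : ℂ) * (θ * I)) +
      ∑' k : ℕ, (inner ℂ ((T ^ k) y) x : ℂ) * exp (((1 * k : ℤ) : ℂ) * (θ * I)) -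
      inner ℂ y x := by
  rw [inner_poissonOp, inner_tsum_exp_smul_pow hT, ← inner_conj_symm _ x,
    inner_tsum_exp_smul_pow hT, Complex.conj_tsum]
  congr 3
  funext k
  rw [map_mul, inner_conj_symm, ← Complex.exp_conj]
  congr 2
  simp

lemma continuous_inner_poissonOp_exp_smul {T : E →L[ℂ] E} (hT : Summable fun k : ℕ => ‖T ^ k‖)
    (x y : E) : Continuous fun θ : ℝ => (inner ℂ y (poissonOp (exp (-(θ * I)) • T) x) : ℂ) := by
  simp only [inner_poissonOp_exp_smul hT]
  exact ((continuous_tsum_exp (summable_norm_inner_pow hT x y) (-1)).add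
    (continuous_tsum_exp (summable_norm_inner_pow' hT x y) 1)).sub continuous_const

lemma continuous_tsum_exp_nat {a : ℕ → ℂ} (ha : Summable fun k => ‖a k‖) :
    Continuous fun θ : ℝ => ∑' k : ℕ, a k * exp (((k : ℤ) : ℂ) * (θ * I)) := by
  simpa only [one_mul] using continuous_tsum_exp ha 1

lemma integral_tsum_exp_mul_inner_poissonOp {T : E →L[ℂ] E}
    (hT : Summable fun k : ℕ => ‖T ^ k‖) {a : ℕ → ℂ} (ha : Summable fun k => ‖a k‖)
    (haT : Summable fun k => a k • T ^ k) (x y : E) :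
    ∫ θ in (0 : ℝ)..(2 * Real.pi), (∑' k : ℕ, a k * exp (((k : ℤ) : ℂ) * (θ * I))) *
        inner ℂ y (poissonOp (exp (-(θ * I)) • T) x) =
      2 * Real.pi * inner ℂ y ((∑' k, a k • T ^ k) x) := by
  have hc := summable_norm_inner_pow hT x y
  have hd := summable_norm_inner_pow' hT x y
  have hf := continuous_tsum_exp_nat ha
  simp only [inner_poissonOp_exp_smul hT, mul_sub, mul_add]
  rw [intervalIntegral.integral_sub, intervalIntegral.integral_add,
    integral_tsum_exp_mul ha hc, integral_tsum_exp_mul ha hd, intervalIntegral.integral_mul_const,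
    integral_tsum_exp ha (fun k => (k : ℤ)), inner_tsum_apply haT]
  · have e1 : ∀ k : ℕ, (∑' j : ℕ, if (k : ℤ) + -1 * j = 0 then
        a k * (inner ℂ y ((T ^ j) x) : ℂ) else 0) = inner ℂ y ((a k • T ^ k) x) := by
      intro k
      rw [tsum_eq_single k]
      · simp
      · intro j hj
        rw [if_neg (by omega)]
    have e2 : (∑' k : ℕ, ∑' j : ℕ, if (k : ℤ) + 1 * j = 0 then
        a k * (inner ℂ ((T ^ j) y) x : ℂ) else 0) = a 0 * inner ℂ y x := by
      rw [tsum_eq_single 0, tsum_eq_single 0]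
      · simp
      · intro j hj
        rw [if_neg (by omega)]
      · intro k hk
        refine (tsum_congr fun j => if_neg ?_).trans tsum_zero
        omega
    have e3 : (∑' k : ℕ, if (k : ℤ) = 0 then a k else 0) = a 0 := by
      rw [tsum_eq_single 0]
      · simp
      · intro j hj
        rw [if_neg (by omega)]
    rw [tsum_congr e1, e2, e3]
    ring
  · exact (hf.mul (continuous_tsum_exp hc (-1))).intervalIntegrable _ _
  · exact (hf.mul (continuous_tsum_exp hd 1)).intervalIntegrable _ _
  · exact ((hf.mul (continuous_tsum_exp hc (-1))).add
      (hf.mul (continuous_tsum_exp hd 1))).intervalIntegrable _ _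
  · exact (hf.mul continuous_const).intervalIntegrable _ _

lemma integral_re_inner_poissonOp {T : E →L[ℂ] E} (hT : Summable fun k : ℕ => ‖T ^ k‖) {x : E}
    (hx : ‖x‖ = 1) :
    ∫ θ in (0 : ℝ)..(2 * Real.pi), (inner ℂ x (poissonOp (exp (-(θ * I)) • T) x)).re =
      2 * Real.pi := by
  have hs : ∀ k ∉ ({0} : Finset ℕ), (Pi.single 0 1 : ℕ → ℂ) k = 0 := fun k hk => by
    rw [Finset.mem_singleton] at hk; simp [hk]
  have h := integral_tsum_exp_mul_inner_poissonOp hT (a := Pi.single 0 1)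
    (summable_of_ne_finset_zero (s := {0}) fun k hk => by rw [hs k hk, norm_zero])
    (summable_of_ne_finset_zero (s := {0}) fun k hk => by rw [hs k hk, zero_smul]) x x
  rw [tsum_eq_single 0 fun k hk => by simp [hk]] at h
  have e : ∀ θ : ℝ, ∑' k : ℕ, (Pi.single 0 1 : ℕ → ℂ) k * exp (((k : ℤ) : ℂ) * (θ * I)) = 1 := by
    intro θ
    rw [tsum_eq_single 0 fun k hk => by simp [hk]]
    simp
  simp only [e, one_mul, Pi.single_eq_same, one_smul, pow_zero,
    one_apply_eq_self, inner_self_eq_norm_sq_to_K, hx] at h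
  have h2 := congrArg Complex.re h
  rw [← Complex.reCLM_apply, ← ContinuousLinearMap.intervalIntegral_comp_comm] at h2
  · simpa using h2
  · exact (continuous_inner_poissonOp_exp_smul hT x x).intervalIntegrable _ _

/-- Tangent line inequality for `t ↦ t ^ p`, rescaled. -/
lemma le_rpow_inv_mul {p t M : ℝ} (hp : 1 ≤ p) (ht : 0 ≤ t) (hM : 0 < M) :
    t ≤ M ^ (1 / p) * (t ^ p / (p * M) + (1 - 1 / p)) := by
  have hp0 : 0 < p := by linarith
  have hK : 0 < M ^ (1 / p) := Real.rpow_pos_of_pos hM _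
  have h := one_add_mul_self_le_rpow_one_add (s := t / M ^ (1 / p) - 1)
    (by have : 0 ≤ t / M ^ (1 / p) := by positivity
        linarith) hp
  rw [add_sub_cancel, Real.div_rpow ht hK.le, ← Real.rpow_mul hM.le, one_div_mul_cancel hp0.ne',
    Real.rpow_one] at h
  have h2 : t / M ^ (1 / p) ≤ t ^ p / (p * M) + (1 - 1 / p) := by
    have : t ^ p / (p * M) = (t ^ p / M) / p := by field_simp
    rw [this]
    have h3 : t / M ^ (1 / p) = (1 + p * (t / M ^ (1 / p) - 1)) / p + (1 - 1 / p) := by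
      field_simp; ring
    rw [h3]
    gcongr
  rw [div_le_iff₀ hK] at h2
  linarith

/-- If the Poisson kernel of a contraction `T` is bounded by `M` on the unit circle, then
`‖f(T)‖ ≤ M ^ (1 / p)` whenever `f` has an absolutely convergent Fourier series and `L^p` norm
at most `1` on the circle. -/
lemma norm_tsum_smul_pow_le {T : E →L[ℂ] E} (hT1 : ‖T‖ ≤ 1)
    (hT : Summable fun k : ℕ => ‖T ^ k‖) {M p : ℝ} (hM : 0 < M) (hp : 1 ≤ p)
    (hTM : ∀ (θ : ℝ) (x : E), ‖x‖ = 1 → (inner ℂ x (poissonOp (exp (-(θ * I)) • T) x)).re ≤ M)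
    {a : ℕ → ℂ} (ha : Summable fun k => ‖a k‖) (haT : Summable fun k => a k • T ^ k)
    (hf : (2 * Real.pi)⁻¹ * ∫ θ in (0 : ℝ)..(2 * Real.pi),
      ‖∑' k : ℕ, a k * exp (((k : ℤ) : ℂ) * (θ * I))‖ ^ p ≤ 1) :
    ‖∑' k, a k • T ^ k‖ ≤ M ^ (1 / p) := by
  have hp0 : 0 < p := by linarith
  have hpi : 0 < 2 * Real.pi := by positivity
  set K := M ^ (1 / p) with hK
  have hK0 : 0 < K := Real.rpow_pos_of_pos hM _
  set A := ∑' k, a k • T ^ k with hA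
  have key : ∀ x y : E, ‖x‖ = 1 → ‖y‖ = 1 → ‖(inner ℂ y (A x) : ℂ)‖ ≤ K := by
    intro x y hx hy
    set F : ℝ → ℂ := fun θ => ∑' k : ℕ, a k * exp (((k : ℤ) : ℂ) * (θ * I)) with hF
    set u : ℝ → ℝ := fun θ => (inner ℂ x (poissonOp (exp (-(θ * I)) • T) x)).re with hu
    set v : ℝ → ℝ := fun θ => (inner ℂ y (poissonOp (exp (-(θ * I)) • T) y)).re with hv
    have hFc : Continuous F := continuous_tsum_exp_nat ha
    have huc : Continuous u :=
      Complex.continuous_re.comp (continuous_inner_poissonOp_exp_smul hT x x)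
    have hvc : Continuous v :=
      Complex.continuous_re.comp (continuous_inner_poissonOp_exp_smul hT y y)
    have hFp : Continuous fun θ => ‖F θ‖ ^ p := hFc.norm.rpow_const fun _ => Or.inr hp0.le
    have hpt : ∀ θ : ℝ, ‖F θ * inner ℂ y (poissonOp (exp (-(θ * I)) • T) x)‖ ≤
        K * (1 / p * ‖F θ‖ ^ p + (1 - 1 / p) * ((u θ + v θ) / 2)) := by
      intro θ
      have hS1 : ‖exp (-(θ * I)) • T‖ ≤ 1 := by
        rwa [norm_smul, norm_exp_neg_ofReal_mul_I, one_mul]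
      have hS : Summable fun k : ℕ => (exp (-(θ * I)) • T) ^ k :=
        Summable.of_norm (by simpa only [norm_exp_smul_pow] using hT)
      have h1 := norm_inner_poissonOp_le hS1 hS x y
      have h2 := le_rpow_inv_mul hp (norm_nonneg (F θ)) hM
      have h3 : 0 ≤ (u θ + v θ) / 2 := (norm_nonneg _).trans h1
      have h4 : (u θ + v θ) / 2 ≤ M := by linarith [hTM θ x hx, hTM θ y hy]
      have h5 : 0 ≤ K * (‖F θ‖ ^ p / (p * M) + (1 - 1 / p)) := (norm_nonneg _).trans h2
      rw [norm_mul]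
      calc _ ≤ K * (‖F θ‖ ^ p / (p * M) + (1 - 1 / p)) * ((u θ + v θ) / 2) := by gcongr
        _ = K * (‖F θ‖ ^ p / (p * M) * ((u θ + v θ) / 2) + (1 - 1 / p) * ((u θ + v θ) / 2)) := by
            ring
        _ ≤ K * (‖F θ‖ ^ p / (p * M) * M + (1 - 1 / p) * ((u θ + v θ) / 2)) := by gcongr
        _ = _ := by field_simp
    have hint := intervalIntegral.norm_integral_le_of_norm_le (μ := MeasureTheory.volume) hpi.le
      (Filter.Eventually.of_forall fun θ _ => hpt θ)
      ((by fun_prop : Continuous fun θ => K * (1 / p * ‖F θ‖ ^ p +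
        (1 - 1 / p) * ((u θ + v θ) / 2))).intervalIntegrable _ _)
    rw [integral_tsum_exp_mul_inner_poissonOp hT ha haT, ← hA,
      intervalIntegral.integral_const_mul, intervalIntegral.integral_add,
      intervalIntegral.integral_const_mul, intervalIntegral.integral_const_mul,
      intervalIntegral.integral_div, intervalIntegral.integral_add,
      integral_re_inner_poissonOp hT hx, integral_re_inner_poissonOp hT hy] at hint
    · rw [inv_mul_le_iff₀ hpi, mul_one] at hf
      have h5 : ‖(2 * Real.pi * inner ℂ y (A x) : ℂ)‖ = 2 * Real.pi * ‖(inner ℂ y (A x) : ℂ)‖ := by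
        rw [norm_mul, ← Complex.ofReal_ofNat, ← Complex.ofReal_mul, Complex.norm_real,
          Real.norm_of_nonneg hpi.le]
      rw [h5] at hint
      refine le_of_mul_le_mul_left (hint.trans ?_) hpi
      calc _ ≤ K * (1 / p * (2 * Real.pi) +
            (1 - 1 / p) * ((2 * Real.pi + 2 * Real.pi) / 2)) := by gcongr
        _ = _ := by ring
    · exact huc.intervalIntegrable _ _
    · exact hvc.intervalIntegrable _ _
    · exact (hFp.const_mul _).intervalIntegrable _ _
    · exact (((huc.add hvc).div_const 2).const_mul _).intervalIntegrable _ _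
  refine ContinuousLinearMap.opNorm_le_of_unit_norm hK0.le fun x hx => ?_
  rcases eq_or_ne (A x) 0 with h0 | h0
  · rw [h0, norm_zero]; exact hK0.le
  · have hn : ‖A x‖ ≠ 0 := norm_ne_zero_iff.2 h0
    have h := key x ((‖A x‖⁻¹ : ℂ) • A x) hx (by simp [norm_smul, hn])
    rw [inner_smul_left, inner_self_eq_norm_sq_to_K, norm_mul] at h
    simpa [pow_two, hn] using h

end Calculus

/-- Corollary 2.2, Hardy case, upper bound: there is `C_p > 0` such that for every
`n×n` contraction `T` (operator norm w.r.t. the Euclidean norm on `ℂ^n`) whose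
eigenvalues all have modulus `≤ r < 1`, and every holomorphic `f = Σ a_k z^k` on `D`
with `‖f‖_{H^p} ≤ 1`, the series `f(T) = Σ a_k T^k` converges and
`‖f(T)‖ ≤ C_p (n/(1-r))^{1/p}`. -/
theorem matrix_functional_calculus_hardy_bound (p : ℝ) (hp : 1 ≤ p) :
    ∃ C : ℝ, 0 < C ∧
      ∀ (n : ℕ), 1 ≤ n → ∀ r : ℝ, 0 ≤ r → r < 1 →
      ∀ T : EuclideanSpace ℂ (Fin n) →L[ℂ] EuclideanSpace ℂ (Fin n),
      ‖T‖ ≤ 1 →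
      (∀ μ : ℂ, Module.End.HasEigenvalue
          (T.toLinearMap :
            Module.End ℂ (EuclideanSpace ℂ (Fin n))) μ → ‖μ‖ ≤ r) →
      ∀ f : ℂ → ℂ, ∀ a : ℕ → ℂ,
      DifferentiableOn ℂ f (ball (0:ℂ) 1) →
      -- `f(z) = Σ_{k ≥ 0} a_k z^k` on `D`
      (∀ z ∈ ball (0:ℂ) 1, HasSum (fun k => a k * z ^ k) (f z)) →
      -- `‖f‖_{H^p} ≤ 1`
      (∀ ρ : ℝ, 0 < ρ → ρ < 1 →
        ((2 * Real.pi)⁻¹ * ∫ θ in (0:ℝ)..(2 * Real.pi),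
          ‖f ((ρ : ℂ) * Complex.exp ((θ : ℂ) * Complex.I))‖ ^ p) ≤ 1) →
      ∃ S : EuclideanSpace ℂ (Fin n) →L[ℂ] EuclideanSpace ℂ (Fin n),
        HasSum (fun k => a k • T ^ k) S ∧
        ‖S‖ ≤ C * ((n : ℝ) / (1 - r)) ^ (1 / p) := by
  refine ⟨2 ^ (1 / p), by positivity, ?_⟩
  intro n hn r hr0 hr1 T hT1 hev f a _ hfa hf
  have : Nonempty (Fin n) := ⟨⟨0, hn⟩⟩
  have hspec : ∀ μ ∈ spectrum ℂ T, ‖μ‖ ≤ r := fun μ hμ =>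
    hev μ (Module.End.hasEigenvalue_iff_mem_spectrum.2 (by rwa [spectrum_toLinearMap]))
  obtain ⟨s, hrs, hs1⟩ := exists_between hr1
  have hs0 : 0 < s := hr0.trans_lt hrs
  have hTs := eventually_norm_pow_le_of_spectrum T hspec hr0 hrs
  have hT : Summable fun k : ℕ => ‖T ^ k‖ :=
    Summable.of_norm_bounded_eventually_nat (summable_geometric_of_lt_one hs0.le hs1)
      (by simpa using hTs)
  have hball : ∀ ρ : ℝ, 0 < ρ → ρ < 1 → ∀ θ : ℝ,
      (ρ : ℂ) * exp (θ * I) ∈ ball (0 : ℂ) 1 := by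
    intro ρ h0 h1 θ
    rw [mem_ball_zero_iff, norm_mul, Complex.norm_exp_ofReal_mul_I, mul_one, Complex.norm_real,
      Real.norm_of_nonneg h0.le]
    exact h1
  have haρ : ∀ ρ : ℝ, 0 < ρ → ρ < 1 → Summable fun k => ‖a k * (ρ : ℂ) ^ k‖ := by
    intro ρ h0 h1
    have := (hfa _ (hball ρ h0 h1 0)).summable.norm
    simpa using this
  have haT : Summable fun k => ‖a k • T ^ k‖ := by
    refine Summable.of_norm_bounded_eventually_nat (haρ s hs0 hs1) ?_
    filter_upwards [hTs] with k hk
    rw [norm_norm, norm_smul, norm_mul, norm_pow (s : ℂ), Complex.norm_real,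
      Real.norm_of_nonneg hs0.le]
    gcongr
  refine ⟨_, haT.of_norm.hasSum, ?_⟩
  have hM : (0 : ℝ) < 2 * (n / (1 - r)) := by
    have : (0 : ℝ) < n := by exact_mod_cast hn
    have : 0 < 1 - r := by linarith
    positivity
  have hnr : (0 : ℝ) ≤ n / (1 - r) := by linarith
  rw [← Real.mul_rpow zero_le_two hnr]
  have hPM : ∀ (θ : ℝ) (x : EuclideanSpace ℂ (Fin n)), ‖x‖ = 1 →
      (inner ℂ x (poissonOp (exp (-(θ * I)) • T) x)).re ≤ 2 * (n / (1 - r)) := by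
    intro θ x hx
    have hS1 : ‖exp (-(θ * I)) • T‖ ≤ 1 := by
      rwa [norm_smul, norm_exp_neg_ofReal_mul_I, one_mul]
    have hS : Summable fun k : ℕ => (exp (-(θ * I)) • T) ^ k :=
      Summable.of_norm (by simpa only [norm_exp_smul_pow] using hT)
    have h := trace_poissonOp_re_le hS hr0 hr1 (by
      rw [spectrum.smul_eq_smul _ _ (spectrum.nonempty T)]
      rintro _ ⟨μ, hμ, rfl⟩
      simpa [norm_smul, norm_exp_neg_ofReal_mul_I] using hspec μ hμ)
    rw [finrank_euclideanSpace_fin] at h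
    exact (re_inner_poissonOp_le_trace hS1 hS hx).trans h
  have hbound : ∀ ρ : ℝ, 0 < ρ → ρ < 1 →
      ‖∑' k, (a k * (ρ : ℂ) ^ k) • T ^ k‖ ≤ (2 * (n / (1 - r))) ^ (1 / p) := by
    intro ρ h0 h1
    refine norm_tsum_smul_pow_le hT1 hT hM hp hPM (haρ ρ h0 h1) ?_ ?_
    · refine Summable.of_norm_bounded haT fun k => ?_
      rw [norm_smul, norm_smul, norm_mul, norm_pow (ρ : ℂ), Complex.norm_real,
        Real.norm_of_nonneg h0.le]
      gcongr
      exact mul_le_of_le_one_right (norm_nonneg _) (pow_le_one₀ h0.le h1.le)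
    · convert hf ρ h0 h1 using 6 with θ
      rw [← (hfa _ (hball ρ h0 h1 θ)).tsum_eq]
      refine tsum_congr fun k => ?_
      rw [mul_pow, ← Complex.exp_nat_mul, mul_assoc, Int.cast_natCast]
  have hlim : Filter.Tendsto (fun ρ : ℝ => ∑' k, (a k * (ρ : ℂ) ^ k) • T ^ k)
      (nhdsWithin 1 (Set.Iio 1)) (nhds (∑' k, a k • T ^ k)) := by
    refine tendsto_tsum_of_dominated_convergence haT (fun k => ?_) ?_
    · have hc : Continuous fun ρ : ℝ => (a k * (ρ : ℂ) ^ k) • T ^ k := by fun_prop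
      simpa using (hc.tendsto 1).mono_left nhdsWithin_le_nhds
    · filter_upwards [Ioo_mem_nhdsLT (zero_lt_one' ℝ)] with ρ hρ k
      rw [norm_smul, norm_smul, norm_mul, norm_pow (ρ : ℂ), Complex.norm_real,
        Real.norm_of_nonneg hρ.1.le]
      gcongr
      exact mul_le_of_le_one_right (norm_nonneg _) (pow_le_one₀ hρ.1.le hρ.2.le)
  refine le_of_tendsto hlim.norm ?_
  filter_upwards [Ioo_mem_nhdsLT (zero_lt_one' ℝ)] with ρ hρ
  exact hbound ρ hρ.1 hρ.2
end
end

section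
/- Let r ∈ [0, 1), n ≥ 1, and let Q_n(z) = ((1−r^2)/(1+rz)^2) · (Σ_{k=0}^{n−1} b_{−r}(z)^k)^2, where b_{−r}(z) = (−r−z)/(1+rz). Then for every p ∈ [1, ∞), ‖Q_n‖_{H^p} ≤ n^{2−1/p} · ((1+r)/(1−r))^{1−1/p}. -/
open Complex Metric

noncomputable section

/-- The test function
`Q_n(z) = ((1-r^2)/(1+rz)^2) (Σ_{k=0}^{n-1} b_{-r}(z)^k)^2`. -/
def Qfun (n : ℕ) (r : ℝ) (z : ℂ) : ℂ :=
  ((1 - (r : ℂ) ^ 2) / (1 + (r : ℂ) * z) ^ 2) *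
    (∑ k ∈ Finset.range n, blaschkeF (-(r : ℂ)) z ^ k) ^ 2

/-- Rotating the argument of a continuous function on a disc is continuous in the angle. -/
theorem continuous_comp_mul_circleMap {g : ℂ → ℂ} {R : ℝ} (hg : ContinuousOn g (ball 0 R))
    {z : ℂ} (hz : z ∈ ball (0 : ℂ) R) : Continuous fun θ : ℝ ↦ g (z * circleMap 0 1 θ) := by
  refine hg.comp_continuous (by fun_prop) fun θ ↦ ?_
  simpa using hz

open Real in
/-- An angular integral of rotations of a holomorphic function is holomorphic. -/
theorem differentiableOn_integral_mul_circleMap {g : ℂ → ℂ} {R S : ℝ} (hS : S < R)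
    (hg : DifferentiableOn ℂ g (ball 0 R)) {c : ℝ → ℂ} (hc : Continuous c) :
    DifferentiableOn ℂ (fun z ↦ ∫ θ in (0 : ℝ)..(2 * π), g (z * circleMap 0 1 θ) * c θ)
      (ball 0 S) := by
  intro z hz
  have hsub : closedBall (0 : ℂ) S ⊆ ball 0 R := closedBall_subset_ball hS
  have hd : ContinuousOn (deriv g) (ball 0 R) := (hg.deriv isOpen_ball).continuousOn
  obtain ⟨M, hM⟩ := (isCompact_closedBall (0 : ℂ) S).exists_bound_of_continuousOn (hd.mono hsub)
  have hcont : ∀ w ∈ ball (0 : ℂ) S, Continuous fun θ ↦ g (w * circleMap 0 1 θ) * c θ :=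
    fun w hw ↦ (continuous_comp_mul_circleMap hg.continuousOn
      (hsub (ball_subset_closedBall hw))).mul hc
  have hcont' : Continuous fun θ ↦ deriv g (z * circleMap 0 1 θ) * circleMap 0 1 θ * c θ :=
    ((continuous_comp_mul_circleMap hd (hsub (ball_subset_closedBall hz))).mul
      (continuous_circleMap 0 1)).mul hc
  refine (intervalIntegral.hasDerivAt_integral_of_dominated_loc_of_deriv_le
    (F' := fun w θ ↦ deriv g (w * circleMap 0 1 θ) * circleMap 0 1 θ * c θ)
    (bound := fun θ ↦ M * ‖c θ‖) (isOpen_ball.mem_nhds hz) ?_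
    ((hcont z hz).intervalIntegrable _ _) hcont'.aestronglyMeasurable ?_
    ((continuous_const.mul hc.norm).intervalIntegrable _ _)
    ?_).2.differentiableAt.differentiableWithinAt
  · filter_upwards [isOpen_ball.mem_nhds hz] with w hw
    exact (hcont w hw).aestronglyMeasurable
  · refine .of_forall fun θ _ w hw ↦ ?_
    rw [norm_mul, norm_mul]
    have : w * circleMap 0 1 θ ∈ closedBall (0 : ℂ) S := by
      simpa using (mem_ball_zero_iff.1 hw).le
    have h1 : ‖circleMap 0 1 θ‖ = 1 := by simp
    rw [h1, mul_one]
    gcongr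
    exact hM _ this
  · refine .of_forall fun θ _ w hw ↦ ?_
    have hmem : w * circleMap 0 1 θ ∈ ball (0 : ℂ) R := by
      simpa using (mem_ball_zero_iff.1 hw).trans hS
    have h1 : HasDerivAt g (deriv g (w * circleMap 0 1 θ)) (w * circleMap 0 1 θ) :=
      (hg.differentiableAt (isOpen_ball.mem_nhds hmem)).hasDerivAt
    have h2 : HasDerivAt (fun w : ℂ ↦ w * circleMap 0 1 θ) (circleMap 0 1 θ) w := by
      simpa using (hasDerivAt_id w).mul_const (circleMap 0 1 θ)
    exact (h1.comp w h2).mul_const _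

open Real in
/-- The quadratic mean of a holomorphic function on a circle inside the unit disc is at most the
one on the unit circle. -/
theorem circleAverage_norm_sq_le {g : ℂ → ℂ} {R : ℝ} (hR : 1 < R)
    (hg : DifferentiableOn ℂ g (ball 0 R)) {ρ : ℝ} (hρ0 : 0 < ρ) (hρ1 : ρ < 1) :
    circleAverage (fun z ↦ ‖g z‖ ^ 2) 0 ρ ≤ circleAverage (fun z ↦ ‖g z‖ ^ 2) 0 1 := by
  have hmul : ∀ θ, (ρ : ℂ) * circleMap 0 1 θ = circleMap 0 ρ θ := fun θ ↦ by
    simp [circleMap_zero]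
  have hmemρ : (ρ : ℂ) ∈ ball (0 : ℂ) R := by
    simpa [abs_of_pos hρ0] using hρ1.trans hR
  have hcρ : Continuous fun θ ↦ g (circleMap 0 ρ θ) := by
    simpa only [hmul] using continuous_comp_mul_circleMap hg.continuousOn hmemρ
  set c : ℝ → ℂ := fun θ ↦ (starRingEnd ℂ) (g (circleMap 0 ρ θ)) with hcdef
  have hc : Continuous c := Complex.continuous_conj.comp hcρ
  set F : ℂ → ℂ := fun z ↦ ∫ θ in (0 : ℝ)..(2 * π), g (z * circleMap 0 1 θ) * c θ with hF
  have hFd : DiffContOnCl ℂ F (ball 0 1) := by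
    have := differentiableOn_integral_mul_circleMap (S := (1 + R) / 2) (by linarith) hg hc
    refine DifferentiableOn.diffContOnCl (this.mono ?_)
    rw [closure_ball _ one_ne_zero]
    exact closedBall_subset_ball (by linarith)
  set A := ∫ θ in (0 : ℝ)..(2 * π), ‖g (circleMap 0 ρ θ)‖ ^ 2 with hA
  set B := ∫ θ in (0 : ℝ)..(2 * π), ‖g (circleMap 0 1 θ)‖ ^ 2 with hB
  have hbound : ∀ z ∈ frontier (ball (0 : ℂ) 1), ‖F z‖ ≤ (B + A) / 2 := by
    intro z hz
    rw [frontier_ball _ one_ne_zero, mem_sphere_zero_iff_norm] at hz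
    have hzR : z ∈ ball (0 : ℂ) R := by simpa [hz] using hR
    have hcz := continuous_comp_mul_circleMap hg.continuousOn hzR
    have hrot : ∫ θ in (0 : ℝ)..(2 * π), ‖g (z * circleMap 0 1 θ)‖ ^ 2 = B := by
      have hz' : z = circleMap 0 1 z.arg := by
        have := Complex.norm_mul_exp_arg_mul_I z
        rw [hz] at this
        rw [circleMap_zero]; exact this.symm
      have h := circleAverage_eq_integral_add (f := fun z ↦ ‖g z‖ ^ 2) (c := 0) (R := 1) z.arg
      rw [circleAverage_def] at h
      have h' := smul_right_injective ℝ (inv_ne_zero two_pi_pos.ne') h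
      rw [hB, h']
      congr 1 with θ
      rw [hz', circleMap_zero_mul, ← hz', one_mul, add_comm]
    calc ‖F z‖ ≤ ∫ θ in (0 : ℝ)..(2 * π), ‖g (z * circleMap 0 1 θ) * c θ‖ :=
          intervalIntegral.norm_integral_le_integral_norm two_pi_pos.le
      _ ≤ ∫ θ in (0 : ℝ)..(2 * π),
            (‖g (z * circleMap 0 1 θ)‖ ^ 2 + ‖g (circleMap 0 ρ θ)‖ ^ 2) / 2 := by
          refine intervalIntegral.integral_mono_on two_pi_pos.le
            ((hcz.mul hc).norm.intervalIntegrable _ _)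
            ((((hcz.norm.pow 2).add (hcρ.norm.pow 2)).div_const 2).intervalIntegrable _ _)
            fun θ _ ↦ ?_
          rw [norm_mul, hcdef, RCLike.norm_conj]
          nlinarith [sq_nonneg (‖g (z * circleMap 0 1 θ)‖ - ‖g (circleMap 0 ρ θ)‖)]
      _ = (B + A) / 2 := by
          rw [intervalIntegral.integral_div, ← hrot, hA]
          congr 1
          exact intervalIntegral.integral_add ((hcz.norm.pow 2).intervalIntegrable _ _)
            ((hcρ.norm.pow 2).intervalIntegrable _ _)
  have hFρ : F ρ = (A : ℂ) := by
    rw [hF, hA, ← intervalIntegral.integral_ofReal]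
    simp only [hmul, hcdef, Complex.mul_conj, Complex.normSq_eq_norm_sq]
  have hmax := Complex.norm_le_of_forall_mem_frontier_norm_le isBounded_ball hFd hbound
    (z := (ρ : ℂ)) (subset_closure (by simpa [abs_of_pos hρ0] using hρ1))
  rw [hFρ, Complex.norm_real, Real.norm_eq_abs] at hmax
  have hAB : A ≤ B := by linarith [le_abs_self A]
  simp only [circleAverage_def, smul_eq_mul]
  exact mul_le_mul_of_nonneg_left hAB (inv_nonneg.2 two_pi_pos.le)

theorem blaschkeF_neg_ofReal (r : ℝ) (z : ℂ) :
    blaschkeF (-(r : ℂ)) z = -((r + z) / (1 + r * z)) := by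
  simp only [blaschkeF, map_neg, Complex.conj_ofReal]
  rw [← neg_div]
  congr 1 <;> ring

theorem one_add_ofReal_mul_ne_zero {r : ℝ} (hr0 : 0 ≤ r) (hr1 : r < 1) {z : ℂ}
    (hz : z ∈ ball (0 : ℂ) (2 / (1 + r))) : 1 + (r : ℂ) * z ≠ 0 := by
  intro h
  have h1 : ‖(r : ℂ) * z‖ = 1 := by
    rw [eq_neg_of_add_eq_zero_right h]; simp
  rw [norm_mul, Complex.norm_real, Real.norm_eq_abs, abs_of_nonneg hr0] at h1
  have h2 : ‖z‖ * (1 + r) < 2 := by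
    rw [← lt_div_iff₀ (by linarith)]; exact mem_ball_zero_iff.1 hz
  nlinarith [norm_nonneg z]

theorem mem_ball_two_div_of_norm_le_one {r : ℝ} (hr0 : 0 ≤ r) (hr1 : r < 1) {z : ℂ}
    (hz : ‖z‖ ≤ 1) : z ∈ ball (0 : ℂ) (2 / (1 + r)) := by
  rw [mem_ball_zero_iff]
  refine hz.trans_lt ?_
  rw [lt_div_iff₀ (by linarith)]
  linarith

theorem differentiableOn_sum_blaschkeF {r : ℝ} (hr0 : 0 ≤ r) (hr1 : r < 1) (n : ℕ) :
    DifferentiableOn ℂ (fun z ↦ ∑ k ∈ Finset.range n, blaschkeF (-(r : ℂ)) z ^ k)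
      (ball 0 (2 / (1 + r))) := by
  refine DifferentiableOn.fun_sum fun k _ ↦ DifferentiableOn.fun_pow ?_ k
  refine DifferentiableOn.congr ?_ fun z _ ↦ blaschkeF_neg_ofReal r z
  exact ((by fun_prop : Differentiable ℂ fun z : ℂ ↦ (r : ℂ) + z).differentiableOn.div
    (by fun_prop) fun z hz ↦ one_add_ofReal_mul_ne_zero hr0 hr1 hz).neg

theorem norm_blaschkeF_le_one_s15 {r : ℝ} (hr0 : 0 ≤ r) (hr1 : r < 1) {z : ℂ} (hz : ‖z‖ ≤ 1) :
    ‖blaschkeF (-(r : ℂ)) z‖ ≤ 1 := by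
  rw [blaschkeF_neg_ofReal, norm_neg, norm_div]
  refine div_le_one_of_le₀ ?_ (norm_nonneg _)
  rw [← sq_le_sq₀ (norm_nonneg _) (norm_nonneg _), ← Complex.normSq_eq_norm_sq,
    ← Complex.normSq_eq_norm_sq]
  have h : Complex.normSq z ≤ 1 := by
    rw [Complex.normSq_eq_norm_sq]; nlinarith [norm_nonneg z]
  simp only [Complex.normSq_apply, Complex.add_re, Complex.add_im, Complex.mul_re, Complex.mul_im,
    Complex.ofReal_re, Complex.ofReal_im, Complex.one_re, Complex.one_im] at h ⊢
  nlinarith [mul_nonneg (by nlinarith : (0 : ℝ) ≤ 1 - r ^ 2) (sub_nonneg.2 h)]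

theorem norm_sum_blaschkeF_le {r : ℝ} (hr0 : 0 ≤ r) (hr1 : r < 1) {z : ℂ} (hz : ‖z‖ ≤ 1)
    (n : ℕ) : ‖∑ k ∈ Finset.range n, blaschkeF (-(r : ℂ)) z ^ k‖ ≤ n := by
  refine (norm_sum_le_of_le _ fun k _ ↦ ?_).trans_eq (by simp : ∑ k ∈ Finset.range n, (1 : ℝ) = n)
  rw [norm_pow]
  exact pow_le_one₀ (norm_nonneg _) (norm_blaschkeF_le_one_s15 hr0 hr1 hz)

theorem norm_Qfun {r : ℝ} (hr0 : 0 ≤ r) (hr1 : r < 1) (n : ℕ) (z : ℂ) :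
    ‖Qfun n r z‖ = (1 - r ^ 2) *
      ‖(∑ k ∈ Finset.range n, blaschkeF (-(r : ℂ)) z ^ k) / (1 + r * z)‖ ^ 2 := by
  have h : ‖1 - (r : ℂ) ^ 2‖ = 1 - r ^ 2 := by
    rw [← Complex.ofReal_pow, ← Complex.ofReal_one, ← Complex.ofReal_sub, Complex.norm_real,
      Real.norm_eq_abs, abs_of_nonneg (by nlinarith)]
  simp only [Qfun, norm_mul, norm_div, norm_pow, h]
  ring

theorem norm_Qfun_le {r : ℝ} (hr0 : 0 ≤ r) (hr1 : r < 1) (n : ℕ) {z : ℂ} (hz : ‖z‖ ≤ 1) :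
    ‖Qfun n r z‖ ≤ n ^ 2 * ((1 + r) / (1 - r)) := by
  have h1 : 1 - r ≤ ‖1 + (r : ℂ) * z‖ := by
    have h := norm_sub_norm_le (1 : ℂ) (-((r : ℂ) * z))
    rw [sub_neg_eq_add, norm_neg, norm_mul, Complex.norm_real, Real.norm_eq_abs,
      abs_of_nonneg hr0, norm_one] at h
    nlinarith
  have h0 : 0 < 1 - r := by linarith
  rw [norm_Qfun hr0 hr1, norm_div]
  calc (1 - r ^ 2) * (‖∑ k ∈ Finset.range n, blaschkeF (-(r : ℂ)) z ^ k‖ / ‖1 + (r : ℂ) * z‖) ^ 2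
      ≤ (1 - r ^ 2) * (n / (1 - r)) ^ 2 := by
        have : 0 ≤ 1 - r ^ 2 := by nlinarith
        gcongr
        exact norm_sum_blaschkeF_le hr0 hr1 hz n
    _ = n ^ 2 * ((1 + r) / (1 - r)) := by
        field_simp
        ring

/-- On the unit circle, passing from `Q_n` to `Q_{n+1}` changes the modulus by the real part of a
holomorphic function. -/
theorem norm_Qfun_succ {r : ℝ} (hr0 : 0 ≤ r) (hr1 : r < 1) (n : ℕ) {z : ℂ} (hz : ‖z‖ = 1) :
    ‖Qfun (n + 1) r z‖ = ‖Qfun n r z‖ + ((1 - r * z) / (1 + r * z) -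
      2 * (1 - (r : ℂ) ^ 2) * z * (∑ k ∈ Finset.range n, blaschkeF (-(r : ℂ)) z ^ k) /
        (1 + r * z) ^ 2).re := by
  have hne : 1 + (r : ℂ) * z ≠ 0 :=
    one_add_ofReal_mul_ne_zero hr0 hr1 (mem_ball_two_div_of_norm_le_one hr0 hr1 hz.le)
  have hne' : 1 + (r : ℂ) * (starRingEnd ℂ) z ≠ 0 := by
    intro h
    apply hne
    have := congrArg (starRingEnd ℂ) h
    simpa using this
  have hzz : z * (starRingEnd ℂ) z = 1 := by
    rw [Complex.mul_conj, Complex.normSq_eq_norm_sq, hz]; simp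
  rw [norm_Qfun hr0 hr1, norm_Qfun hr0 hr1, Finset.sum_range_succ']
  simp only [pow_succ, pow_zero, ← Finset.sum_mul]
  set S := ∑ k ∈ Finset.range n, blaschkeF (-(r : ℂ)) z ^ k
  rw [blaschkeF_neg_ofReal]
  apply Complex.ofReal_injective
  simp only [one_mul, ← pow_two]
  rw [Complex.ofReal_add, Complex.re_eq_add_conj]
  push_cast
  rw [← Complex.mul_conj', ← Complex.mul_conj']
  simp only [map_add, map_sub, map_mul, map_div₀, map_neg, map_pow, map_one, map_ofNat,
    Complex.conj_ofReal]
  set w := (starRingEnd ℂ) z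
  set T := (starRingEnd ℂ) S
  have hw : w = z⁻¹ := eq_inv_of_mul_eq_one_right hzz
  have hz0 : z ≠ 0 := left_ne_zero_of_mul_eq_one hzz
  rw [hw] at hne' ⊢
  have hne2 : z + r ≠ 0 := by
    intro h; apply hne'; field_simp; simpa using h
  field_simp
  ring

theorem differentiableOn_sum_blaschkeF_div {r : ℝ} (hr0 : 0 ≤ r) (hr1 : r < 1) (n : ℕ) :
    DifferentiableOn ℂ
      (fun z ↦ (∑ k ∈ Finset.range n, blaschkeF (-(r : ℂ)) z ^ k) / (1 + r * z))
      (ball 0 (2 / (1 + r))) :=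
  (differentiableOn_sum_blaschkeF hr0 hr1 n).fun_div (by fun_prop)
    fun _ hz ↦ one_add_ofReal_mul_ne_zero hr0 hr1 hz

theorem continuousOn_norm_Qfun {r : ℝ} (hr0 : 0 ≤ r) (hr1 : r < 1) (n : ℕ) :
    ContinuousOn (fun z ↦ ‖Qfun n r z‖) (closedBall 0 1) := by
  simp only [norm_Qfun hr0 hr1]
  exact continuousOn_const.mul (((differentiableOn_sum_blaschkeF_div hr0 hr1 n).continuousOn.mono
    fun z hz ↦ mem_ball_two_div_of_norm_le_one hr0 hr1 (mem_closedBall_zero_iff.1 hz)).norm.pow 2)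

theorem circleIntegrable_norm_Qfun {r : ℝ} (hr0 : 0 ≤ r) (hr1 : r < 1) (n : ℕ) {ρ : ℝ}
    (hρ0 : 0 ≤ ρ) (hρ1 : ρ ≤ 1) : CircleIntegrable (fun z ↦ ‖Qfun n r z‖) 0 ρ :=
  ((continuousOn_norm_Qfun hr0 hr1 n).mono
    (sphere_subset_closedBall.trans (closedBall_subset_closedBall hρ1))).circleIntegrable hρ0

open Real in
theorem circleAverage_norm_Qfun_one {r : ℝ} (hr0 : 0 ≤ r) (hr1 : r < 1) (n : ℕ) :
    circleAverage (fun z ↦ ‖Qfun n r z‖) 0 1 = n := by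
  induction n with
  | zero => simp [Qfun, circleAverage_const]
  | succ n ih =>
    set h : ℂ → ℂ := fun z ↦ (1 - r * z) / (1 + r * z) -
      2 * (1 - (r : ℂ) ^ 2) * z * (∑ k ∈ Finset.range n, blaschkeF (-(r : ℂ)) z ^ k) /
        (1 + r * z) ^ 2 with hh
    have hball : closedBall (0 : ℂ) |1| ⊆ ball 0 (2 / (1 + r)) := fun z hz ↦
      mem_ball_two_div_of_norm_le_one hr0 hr1 (by simpa using hz)
    have hdiff : DifferentiableOn ℂ h (ball 0 (2 / (1 + r))) := by
      have hne := fun z hz ↦ one_add_ofReal_mul_ne_zero hr0 hr1 (z := z) hz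
      refine DifferentiableOn.fun_sub (DifferentiableOn.fun_div (by fun_prop) (by fun_prop) hne)
        (DifferentiableOn.fun_div (DifferentiableOn.fun_mul (by fun_prop)
          (differentiableOn_sum_blaschkeF hr0 hr1 n)) (by fun_prop)
          fun z hz ↦ pow_ne_zero 2 (hne z hz))
    have hcl : DiffContOnCl ℂ h (ball 0 |1|) := by
      refine DifferentiableOn.diffContOnCl (hdiff.mono ?_)
      rwa [closure_ball _ (by simp)]
    have hint : CircleIntegrable h 0 1 := (hdiff.continuousOn.mono (sphere_subset_closedBall.trans
      (by simpa using hball))).circleIntegrable zero_le_one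
    have hre : circleAverage (fun z ↦ (h z).re) 0 1 = 1 := by
      have := Complex.reCLM.circleAverage_comp_comm hint
      rw [hcl.circleAverage] at this
      simpa [hh, Function.comp_def] using this
    have hreint : CircleIntegrable (fun z ↦ (h z).re) 0 1 :=
      (Complex.continuous_re.comp_continuousOn (hdiff.continuousOn.mono
        (sphere_subset_closedBall.trans (by simpa using hball)))).circleIntegrable zero_le_one
    calc circleAverage (fun z ↦ ‖Qfun (n + 1) r z‖) 0 1
        = circleAverage (fun z ↦ ‖Qfun n r z‖ + (h z).re) 0 1 :=
          circleAverage_congr_sphere fun z hz ↦ norm_Qfun_succ hr0 hr1 n (by simpa using hz)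
      _ = (n + 1 : ℕ) := by
          rw [circleAverage_fun_add (circleIntegrable_norm_Qfun hr0 hr1 n zero_le_one le_rfl)
            hreint, ih, hre]
          push_cast
          rfl

open Real in
theorem circleAverage_norm_Qfun_le {r : ℝ} (hr0 : 0 ≤ r) (hr1 : r < 1) (n : ℕ) {ρ : ℝ}
    (hρ0 : 0 < ρ) (hρ1 : ρ < 1) : circleAverage (fun z ↦ ‖Qfun n r z‖) 0 ρ ≤ n := by
  rw [← circleAverage_norm_Qfun_one hr0 hr1 n]
  simp only [norm_Qfun hr0 hr1, ← smul_eq_mul (a := 1 - r ^ 2), circleAverage_fun_smul]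
  refine smul_le_smul_of_nonneg_left (circleAverage_norm_sq_le ?_
    (differentiableOn_sum_blaschkeF_div hr0 hr1 n) hρ0 hρ1) (by nlinarith)
  rw [lt_div_iff₀ (by linarith)]
  linarith

/-- For every `p ∈ [1, ∞)`,
`‖Q_n‖_{H^p} ≤ n^{2-1/p} ((1+r)/(1-r))^{1-1/p}` (estimate (6.3)). -/
theorem Qfun_Hp_norm_estimate (r : ℝ) (hr0 : 0 ≤ r) (hr1 : r < 1)
    (n : ℕ) (hn : 1 ≤ n) (p : ℝ) (hp : 1 ≤ p) :
    ∀ ρ : ℝ, 0 < ρ → ρ < 1 →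
      ((2 * Real.pi)⁻¹ * ∫ θ in (0:ℝ)..(2 * Real.pi),
          ‖Qfun n r ((ρ : ℂ) * Complex.exp ((θ : ℂ) * Complex.I))‖ ^ p) ^ (1 / p)
        ≤ (n : ℝ) ^ (2 - 1 / p) * ((1 + r) / (1 - r)) ^ (1 - 1 / p) := by
  intro ρ hρ0 hρ1
  have hp0 : 0 < p := by linarith
  have hn0 : (0 : ℝ) < n := by exact_mod_cast hn
  set A : ℝ := (1 + r) / (1 - r) with hA
  have hA0 : 0 < A := div_pos (by linarith) (by linarith)
  set M : ℝ := n ^ 2 * A with hM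
  have hM0 : 0 < M := by positivity
  have hcont : ContinuousOn (fun z ↦ ‖Qfun n r z‖) (sphere 0 ρ) :=
    (continuousOn_norm_Qfun hr0 hr1 n).mono
      (sphere_subset_closedBall.trans (closedBall_subset_closedBall hρ1.le))
  have hmean : Real.circleAverage (fun z ↦ ‖Qfun n r z‖ ^ p) 0 ρ ≤ M ^ (p - 1) * n := by
    calc Real.circleAverage (fun z ↦ ‖Qfun n r z‖ ^ p) 0 ρ
        ≤ Real.circleAverage (fun z ↦ M ^ (p - 1) • ‖Qfun n r z‖) 0 ρ := by
          refine Real.circleAverage_mono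
            ((hcont.rpow_const fun _ _ ↦ .inr hp0.le).circleIntegrable hρ0.le)
            ((hcont.fun_const_smul _).circleIntegrable hρ0.le) fun z hz ↦ ?_
          have hz1 : ‖z‖ ≤ 1 := by
            rw [mem_sphere_zero_iff_norm.1 hz, abs_of_pos hρ0]
            exact hρ1.le
          rw [smul_eq_mul]
          calc ‖Qfun n r z‖ ^ p = ‖Qfun n r z‖ ^ (p - 1) * ‖Qfun n r z‖ := by
                rw [← Real.rpow_add_one' (norm_nonneg _) (by linarith), sub_add_cancel]
            _ ≤ M ^ (p - 1) * ‖Qfun n r z‖ := by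
                gcongr
                exact norm_Qfun_le hr0 hr1 n hz1
      _ ≤ M ^ (p - 1) * n := by
          rw [Real.circleAverage_fun_smul, smul_eq_mul]
          gcongr
          exact circleAverage_norm_Qfun_le hr0 hr1 n hρ0 hρ1
  have hnonneg : 0 ≤ Real.circleAverage (fun z ↦ ‖Qfun n r z‖ ^ p) 0 ρ :=
    Real.circleAverage_nonneg_of_nonneg fun _ _ ↦ by positivity
  rw [Real.circleAverage_def, smul_eq_mul] at hmean hnonneg
  simp only [circleMap_zero] at hmean hnonneg
  refine (Real.rpow_le_rpow hnonneg hmean (by positivity)).trans_eq ?_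
  rw [hM, ← Real.rpow_natCast, Real.mul_rpow (by positivity) hA0.le, ← Real.rpow_mul hn0.le,
    Real.mul_rpow (by positivity) hn0.le, Real.mul_rpow (by positivity) (by positivity),
    ← Real.rpow_mul hn0.le, ← Real.rpow_mul hA0.le, mul_right_comm, ← Real.rpow_add hn0]
  congr 2 <;> push_cast <;> field_simp <;> ring
end
end

section
/- For every integer N ≥ 1 there exists a constant c_N > 0 such that the following holds for every n ≥ 1 and r ∈ [0, 1). Let Ψ_n be the polynomial Ψ_n(z) = (1−r^2)^{−N} · (1 + (1+r)·Σ_{k=1}^{n−1} z^k + r·z^n)^{2N}. Then every bounded holomorphic function g on D whose Taylor coefficients at 0 satisfy ĝ(k) = Ψ̂_n(k) for all 0 ≤ k ≤ n−1 satisfies sup_{z∈D} |g(z)| ≥ c_N · n^{2N} / (1−r)^N. (Estimate (6.5): lower bound for the quotient norm ‖Ψ_n‖_{H^∞ / z^n H^∞}.) -/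
open Complex Metric

noncomputable section

/-- The polynomial
`Ψ_n(z) = (1-r^2)^{-N} (1 + (1+r) Σ_{k=1}^{n-1} z^k + r z^n)^{2N}`. -/
def PsiFun (N n : ℕ) (r : ℝ) (z : ℂ) : ℂ :=
  ((1 - (r : ℂ) ^ 2) ^ N)⁻¹ *
    (1 + (1 + (r : ℂ)) * ∑ k ∈ Finset.Ioo 0 n, z ^ k + (r : ℂ) * z ^ n) ^ (2 * N)

/-- Cauchy's formula for Taylor coefficients, as a circle average. -/
theorem circleAverage_inv_pow_mul {f : ℂ → ℂ} {R : ℝ} (hR : 0 < R) (m : ℕ)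
    (hf : DiffContOnCl ℂ f (ball 0 R)) :
    Real.circleAverage (fun z => (z ^ m)⁻¹ * f z) 0 R = iteratedDeriv m f 0 / m.factorial := by
  have h := hf.circleIntegral_one_div_sub_center_pow_smul hR m
  have h2 : (m.factorial : ℂ) ≠ 0 := by exact_mod_cast m.factorial_ne_zero
  rw [Real.circleAverage_eq_circleIntegral hR.ne']
  have h3 : (∮ z in C(0, R), (z - 0)⁻¹ • ((z ^ m)⁻¹ * f z))
      = ∮ z in C(0, R), (1 / (z - 0) ^ (m + 1)) • f z := by
    congr 1 with z
    simp [pow_succ]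
    ring
  rw [h3, h, smul_eq_mul, smul_eq_mul]
  have := Complex.two_pi_I_ne_zero
  field_simp

theorem iteratedDeriv_polynomial_eval_zero (P : Polynomial ℂ) (m : ℕ) :
    iteratedDeriv m (fun z => P.eval z) 0 = m.factorial * P.coeff m := by
  have h (k : ℕ) : iteratedDeriv k (fun z => P.eval z)
      = fun z => (Polynomial.derivative^[k] P).eval z := by
    induction k with
    | zero => simp
    | succ k ih =>
      rw [iteratedDeriv_succ, ih, Function.iterate_succ_apply']
      ext z
      exact Polynomial.deriv _
  rw [h]
  simp [← Polynomial.coeff_zero_eq_eval_zero, Polynomial.coeff_iterate_derivative, Nat.descFactorial_self]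

theorem conj_geomSum_mul_pow {n : ℕ} (hn : 1 ≤ n) {z : ℂ} (hz : ‖z‖ = 1) :
    (starRingEnd ℂ) (∑ k ∈ Finset.range n, z ^ k) * z ^ (n - 1) = ∑ k ∈ Finset.range n, z ^ k := by
  rw [map_sum, Finset.sum_mul, ← Finset.sum_range_reflect (fun k => z ^ k)]
  refine Finset.sum_congr rfl fun k hk => ?_
  have hk : k + (n - 1 - k) = n - 1 := by have := Finset.mem_range.1 hk; omega
  have h1 : (starRingEnd ℂ) z * z = 1 := by
    rw [mul_comm, Complex.mul_conj, Complex.normSq_eq_norm_sq, hz]; simp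
  have hpow : z ^ (n - 1) = z ^ k * z ^ (n - 1 - k) := by rw [← pow_add, hk]
  rw [hpow, ← mul_assoc, map_pow, ← mul_pow, h1, one_pow, one_mul]

theorem coeff_geomSum_sq {n : ℕ} (hn : 1 ≤ n) :
    ((∑ k ∈ Finset.range n, (Polynomial.X : Polynomial ℂ) ^ k) ^ 2).coeff (n - 1) = n := by
  rw [sq, Polynomial.coeff_mul]
  rw [Finset.sum_congr rfl (g := fun _ => (1 : ℂ))]
  · simp; norm_cast; omega
  · intro x hx
    have := Finset.HasAntidiagonal.mem_antidiagonal.1 hx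
    have h1 : x.1 < n := by omega
    have h2 : x.2 < n := by omega
    simp [Polynomial.finsetSum_coeff, Polynomial.coeff_X_pow, h1, h2]

theorem circleAverage_norm_geomSum_sq {n : ℕ} (hn : 1 ≤ n) :
    Real.circleAverage (fun z : ℂ => ‖∑ k ∈ Finset.range n, z ^ k‖ ^ 2) 0 1 = n := by
  have h := circleAverage_inv_pow_mul one_pos (n - 1)
    (f := fun z : ℂ => ((∑ k ∈ Finset.range n, (Polynomial.X : Polynomial ℂ) ^ k) ^ 2).eval z)
    (Polynomial.differentiable _).diffContOnCl
  rw [iteratedDeriv_polynomial_eval_zero, coeff_geomSum_sq hn,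
    mul_div_cancel_left₀ _ (by exact_mod_cast Nat.factorial_ne_zero _)] at h
  have h2 := ofRealCLM.circleAverage_comp_comm (c := 0) (R := 1)
    (f := fun z : ℂ => ‖∑ k ∈ Finset.range n, z ^ k‖ ^ 2)
    (Continuous.continuousOn (by fun_prop)).circleIntegrable'
  rw [← Complex.ofReal_inj]
  refine (h2.symm.trans ?_).trans h
  refine Real.circleAverage_congr_sphere fun z hz => ?_
  have hz : ‖z‖ = 1 := by simpa using hz
  have hz0 : z ^ (n - 1) ≠ 0 := pow_ne_zero _ (by rintro rfl; simp at hz)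
  simp only [Function.comp, ofRealCLM_apply, Polynomial.eval_pow, Polynomial.eval_finsetSum,
    Polynomial.eval_X]
  rw [← Complex.normSq_eq_norm_sq, ← Complex.mul_conj, eq_inv_mul_iff_mul_eq₀ hz0, sq]
  linear_combination (∑ k ∈ Finset.range n, z ^ k) * conj_geomSum_mul_pow hn hz

/-- If `‖g‖ ≤ M` on the unit disc, then the `(n-1)`-st Taylor coefficient of `g D²`, where
`D = Σ_{k<n} z^k`, is at most `M n`: up to the factor `n`, it is the Fejér mean of `g` at `1`. -/
theorem norm_iteratedDeriv_mul_geomSum_sq_le {g : ℂ → ℂ} {M : ℝ} {n : ℕ} (hn : 1 ≤ n)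
    (hg : DifferentiableOn ℂ g (ball 0 1)) (hM : ∀ z ∈ ball (0 : ℂ) 1, ‖g z‖ ≤ M) :
    ‖iteratedDeriv (n - 1) (fun z => g z * (∑ k ∈ Finset.range n, z ^ k) ^ 2) 0
      / (n - 1).factorial‖ ≤ M * n := by
  set A : ℝ → ℝ := Real.circleAverage (fun z : ℂ => ‖∑ k ∈ Finset.range n, z ^ k‖ ^ 2) 0
  have hA : Continuous A := Real.Continuous.circleAverage (by fun_prop)
  have hlim : Filter.Tendsto (fun ρ : ℝ => (ρ ^ (n - 1))⁻¹ * M * A ρ) (nhdsWithin 1 (Set.Iio 1))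
      (nhds (M * n)) := by
    have : ContinuousAt (fun ρ : ℝ => (ρ ^ (n - 1))⁻¹ * M * A ρ) 1 := by
      fun_prop (disch := simp)
    simpa [A, circleAverage_norm_geomSum_sq hn] using this.tendsto.mono_left nhdsWithin_le_nhds
  refine ge_of_tendsto hlim ?_
  filter_upwards [Ioo_mem_nhdsLT (zero_lt_one' ℝ)] with ρ hρ
  have hsub : closedBall (0 : ℂ) ρ ⊆ ball 0 1 := closedBall_subset_ball hρ.2
  have hf : DifferentiableOn ℂ (fun z => g z * (∑ k ∈ Finset.range n, z ^ k) ^ 2)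
      (ball (0 : ℂ) 1) := hg.mul (by fun_prop)
  rw [← circleAverage_inv_pow_mul hρ.1 _ ((hf.mono hsub).diffContOnCl_ball subset_rfl)]
  rw [Real.circleAverage, norm_smul, Real.norm_of_nonneg (by positivity)]
  have hint : IntervalIntegrable (fun θ => (ρ ^ (n - 1))⁻¹ * M *
      ‖∑ k ∈ Finset.range n, (circleMap 0 ρ θ) ^ k‖ ^ 2) MeasureTheory.volume 0 (2 * Real.pi) :=
    Continuous.intervalIntegrable (by fun_prop) _ _
  have := intervalIntegral.norm_integral_le_of_norm_le
    (f := fun θ => ((circleMap 0 ρ θ) ^ (n - 1))⁻¹ * (g (circleMap 0 ρ θ) *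
      (∑ k ∈ Finset.range n, (circleMap 0 ρ θ) ^ k) ^ 2)) (by positivity)
    (Filter.Eventually.of_forall fun θ _ => by
      have hz : ‖circleMap 0 ρ θ‖ = ρ := by simp [abs_of_pos hρ.1]
      rw [norm_mul, norm_mul, norm_pow, norm_inv, norm_pow, hz, mul_assoc]
      gcongr
      · exact inv_nonneg.2 (pow_nonneg hρ.1.le _)
      exact hM _ (by rw [mem_ball_zero_iff, hz]; exact hρ.2)) hint
  rw [intervalIntegral.integral_const_mul] at this
  calc _ ≤ _ := mul_le_mul_of_nonneg_left this (by positivity)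
    _ = _ := by simp only [A, Real.circleAverage, smul_eq_mul]; ring

/-- Multiplication is monotone for the coefficientwise order below degree `n`. -/
theorem coeff_mul_le_coeff_mul {n : ℕ} {a a' b b' : PowerSeries ℝ}
    (ha : ∀ k < n, 0 ≤ a.coeff k ∧ a.coeff k ≤ a'.coeff k)
    (hb : ∀ k < n, 0 ≤ b.coeff k ∧ b.coeff k ≤ b'.coeff k) :
    ∀ k < n, 0 ≤ (a * b).coeff k ∧ (a * b).coeff k ≤ (a' * b').coeff k := by
  intro k hk
  have hlt : ∀ x ∈ Finset.HasAntidiagonal.antidiagonal k, x.1 < n ∧ x.2 < n := fun x hx => by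
    have := Finset.HasAntidiagonal.mem_antidiagonal.1 hx
    omega
  rw [PowerSeries.coeff_mul, PowerSeries.coeff_mul]
  constructor
  · exact Finset.sum_nonneg fun x hx =>
      mul_nonneg (ha _ (hlt x hx).1).1 (hb _ (hlt x hx).2).1
  · exact Finset.sum_le_sum fun x hx => mul_le_mul (ha _ (hlt x hx).1).2 (hb _ (hlt x hx).2).2
      (hb _ (hlt x hx).2).1 ((ha _ (hlt x hx).1).1.trans (ha _ (hlt x hx).1).2)

theorem coeff_pow_le_coeff_pow {n : ℕ} {a a' : PowerSeries ℝ}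
    (ha : ∀ k < n, 0 ≤ a.coeff k ∧ a.coeff k ≤ a'.coeff k) (m : ℕ) :
    ∀ k < n, 0 ≤ (a ^ m).coeff k ∧ (a ^ m).coeff k ≤ (a' ^ m).coeff k := by
  induction m with
  | zero => intro k _; simp only [pow_zero, le_refl, and_true, PowerSeries.coeff_one]; positivity
  | succ m ih => simpa only [pow_succ] using coeff_mul_le_coeff_mul ih ha

open Polynomial in
/-- The base `1 + (1+r) Σ_{k=1}^{n-1} X^k + r X^n` of `PsiFun`, as a real polynomial. -/
def psiBase (n : ℕ) (r : ℝ) : ℝ[X] :=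
  1 + C (1 + r) * ∑ k ∈ Finset.Ioo 0 n, X ^ k + C r * X ^ n

open Polynomial in
theorem PsiFun_eq_eval_map (N n : ℕ) (r : ℝ) (z : ℂ) :
    PsiFun N n r z =
      ((C ((1 - r ^ 2) ^ N)⁻¹ * psiBase n r ^ (2 * N)).map ofRealHom).eval z := by
  simp [PsiFun, psiBase, eval_finsetSum, Polynomial.map_sum]

theorem one_le_coeff_psiBase {n : ℕ} {r : ℝ} (hr : 0 ≤ r) {k : ℕ} (hk : k < n) :
    1 ≤ (psiBase n r).coeff k := by
  rcases Nat.eq_zero_or_pos k with rfl | hk0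
  · simp [psiBase, Polynomial.finsetSum_coeff, Polynomial.coeff_X_pow, hk.ne]
  · rw [psiBase, Polynomial.coeff_add, Polynomial.coeff_add, Polynomial.coeff_C_mul,
      Polynomial.coeff_C_mul]
    simp [Polynomial.finsetSum_coeff, Polynomial.coeff_X_pow, hk.ne, hk, hk0,
      Polynomial.coeff_one, hk0.ne', hr]

open Polynomial in
theorem pow_div_factorial_le_coeff {N n : ℕ} {r : ℝ} (hn : 1 ≤ n) (hr : 0 ≤ r) :
    (n : ℝ) ^ (2 * N + 1) / (2 * N + 1).factorial ≤
      (psiBase n r ^ (2 * N) * (∑ k ∈ Finset.range n, X ^ k) ^ 2).coeff (n - 1) := by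
  have h1 : ∀ k < n, 0 ≤ (PowerSeries.mk 1 : PowerSeries ℝ).coeff k ∧
      (PowerSeries.mk 1 : PowerSeries ℝ).coeff k ≤ (psiBase n r : PowerSeries ℝ).coeff k :=
    fun k hk => by simpa using one_le_coeff_psiBase hr hk
  have h2 : ∀ k < n, 0 ≤ (PowerSeries.mk 1 : PowerSeries ℝ).coeff k ∧
      (PowerSeries.mk 1 : PowerSeries ℝ).coeff k ≤
        ((∑ k ∈ Finset.range n, X ^ k : ℝ[X]) : PowerSeries ℝ).coeff k :=
    fun k hk => by simp [finsetSum_coeff, coeff_X_pow, hk]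
  have h := (coeff_mul_le_coeff_mul (coeff_pow_le_coeff_pow h1 (2 * N))
    (coeff_pow_le_coeff_pow h2 2) (n - 1) (by omega)).2
  rw [← pow_add, PowerSeries.mk_one_pow_eq_mk_choose_add, PowerSeries.coeff_mk, ← coe_pow,
    ← coe_pow, ← coe_mul, coeff_coe] at h
  refine le_trans ?_ h
  have := Nat.pow_le_choose (α := ℝ) (2 * N + 1) (2 * N + 1 + (n - 1))
  rwa [show 2 * N + 1 + (n - 1) + 1 - (2 * N + 1) = n by omega] at this

theorem iteratedDeriv_mul_congr {𝕜 : Type*} [NontriviallyNormedField 𝕜] {f g h : 𝕜 → 𝕜} {x : 𝕜}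
    {m : ℕ} (hf : ContDiffAt 𝕜 m f x) (hg : ContDiffAt 𝕜 m g x) (hh : ContDiffAt 𝕜 m h x)
    (hfg : ∀ k ≤ m, iteratedDeriv k f x = iteratedDeriv k g x) :
    iteratedDeriv m (f * h) x = iteratedDeriv m (g * h) x := by
  rw [iteratedDeriv_mul hf hh, iteratedDeriv_mul hg hh]
  refine Finset.sum_congr rfl fun k hk => ?_
  rw [hfg k (Nat.lt_succ_iff.1 (Finset.mem_range.1 hk))]

/-- Estimate (6.5): for every `N ≥ 1` there is `c_N > 0` such that for all `n ≥ 1`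
and `r ∈ [0,1)`, every bounded holomorphic `g` on `D` whose first `n` Taylor
coefficients agree with those of `Ψ_n` satisfies
`sup_{z ∈ D} |g(z)| ≥ c_N n^{2N}/(1-r)^N`. -/
theorem Psi_quotient_norm_lower_bound (N : ℕ) (hN : 1 ≤ N) :
    ∃ c : ℝ, 0 < c ∧
      ∀ (n : ℕ), 1 ≤ n → ∀ r : ℝ, 0 ≤ r → r < 1 →
      ∀ g : ℂ → ℂ, DifferentiableOn ℂ g (ball (0:ℂ) 1) →
        -- `ĝ(k) = Ψ̂_n(k)` for `0 ≤ k ≤ n-1`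
        (∀ k < n, iteratedDeriv k g 0 = iteratedDeriv k (PsiFun N n r) 0) →
        ∀ M : ℝ, (∀ z ∈ ball (0:ℂ) 1, ‖g z‖ ≤ M) →
          c * (n : ℝ) ^ (2 * N) / (1 - r) ^ N ≤ M := by
  refine ⟨1 / (2 ^ N * (2 * N + 1).factorial), by positivity, ?_⟩
  intro n hn r hr0 hr1 g hg hgΨ M hM
  set Q : Polynomial ℝ := Polynomial.C ((1 - r ^ 2) ^ N)⁻¹ * psiBase n r ^ (2 * N) *
    (∑ k ∈ Finset.range n, Polynomial.X ^ k) ^ 2 with hQ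
  have hΨ : PsiFun N n r = fun z => Polynomial.eval z
      ((Polynomial.C ((1 - r ^ 2) ^ N)⁻¹ * psiBase n r ^ (2 * N)).map ofRealHom) :=
    funext (PsiFun_eq_eval_map N n r)
  have hcoeff : iteratedDeriv (n - 1) (fun z => g z * (∑ k ∈ Finset.range n, z ^ k) ^ 2) 0
      / (n - 1).factorial = (Q.coeff (n - 1) : ℂ) := by
    have h := iteratedDeriv_mul_congr (m := n - 1)
      (h := fun z : ℂ => (∑ k ∈ Finset.range n, z ^ k) ^ 2)
      (hg.analyticAt (ball_mem_nhds 0 one_pos)).contDiffAt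
      (g := PsiFun N n r) (by rw [hΨ]; exact (Polynomial.differentiable _).contDiff.contDiffAt)
      (ContDiff.contDiffAt (by fun_prop)) fun k hk => hgΨ k (by omega)
    have hprod : PsiFun N n r * (fun z : ℂ => (∑ k ∈ Finset.range n, z ^ k) ^ 2) =
        fun z => (Q.map ofRealHom).eval z := by
      rw [hΨ, hQ]
      ext z
      simp [Polynomial.eval_finsetSum, Polynomial.map_sum]
    rw [hprod, iteratedDeriv_polynomial_eval_zero] at h
    rw [div_eq_iff (by exact_mod_cast Nat.factorial_ne_zero _), mul_comm]
    simpa using! h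
  have hfejer := norm_iteratedDeriv_mul_geomSum_sq_le hn hg hM
  rw [hcoeff, Complex.norm_real, hQ, mul_assoc, Polynomial.coeff_C_mul] at hfejer
  have hlow := pow_div_factorial_le_coeff (N := N) hn hr0
  have hn0 : (0 : ℝ) < n := by exact_mod_cast hn
  have h1r : 0 < 1 - r := by linarith
  have hpos : 0 < (1 - r ^ 2) ^ N := pow_pos (by nlinarith) N
  have hle : (1 - r ^ 2) ^ N ≤ 2 ^ N * (1 - r) ^ N := by
    rw [← mul_pow]
    exact pow_le_pow_left₀ (by nlinarith) (by nlinarith) N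
  refine le_of_mul_le_mul_right ?_ hn0
  calc _ = (2 ^ N * (1 - r) ^ N)⁻¹ * ((n : ℝ) ^ (2 * N + 1) / (2 * N + 1).factorial) := by
        field_simp
        ring
    _ ≤ ((1 - r ^ 2) ^ N)⁻¹ * _ := by gcongr
    _ ≤ M * n := (le_abs_self _).trans hfejer
end
end

section
/- Let p ∈ [1, ∞), β > −1, and let N be an integer with N ≥ β + 2. There exists a constant C > 0 (depending only on p, β and N) such that for every n ≥ 1, the Dirichlet kernel D_n(w) = Σ_{j=0}^{n−1} w^j satisfies ∫_D |D_n(w)|^{2Np} (1−|w|^2)^β dA(w) ≤ C · n^{2pN−2−β}. -/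
open Complex Metric

noncomputable section

open MeasureTheory Set in
/-- The function `u ↦ u ^ β * (1 + u) ^ (-m)` is integrable on `(0, ∞)` for `-1 < β < m - 1`. -/
theorem integrableOn_Ioi_rpow_mul_one_add_rpow_neg {β m : ℝ} (hβ : -1 < β) (h : β - m < -1) :
    IntegrableOn (fun u : ℝ => u ^ β * (1 + u) ^ (-m)) (Ioi 0) := by
  have hmeas : Measurable (fun u : ℝ => u ^ β * (1 + u) ^ (-m)) := by fun_prop
  rw [← Ioc_union_Ioi_eq_Ioi (zero_le_one' ℝ)]
  refine IntegrableOn.union ?_ ?_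
  · have h1 : IntegrableOn (fun u : ℝ => u ^ β) (Ioc 0 1) :=
      (intervalIntegrable_iff_integrableOn_Ioc_of_le zero_le_one).1
        (intervalIntegral.intervalIntegrable_rpow' hβ)
    refine h1.mono' hmeas.aestronglyMeasurable ((ae_restrict_iff' measurableSet_Ioc).2
      (.of_forall fun u hu => ?_))
    have hu0 : 0 < u := hu.1
    rw [Real.norm_of_nonneg (by positivity)]
    exact mul_le_of_le_one_right (by positivity)
      (Real.rpow_le_one_of_one_le_of_nonpos (by linarith) (by linarith))
  · refine (integrableOn_Ioi_rpow_of_lt h zero_lt_one).mono' hmeas.aestronglyMeasurable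
      ((ae_restrict_iff' measurableSet_Ioi).2 (.of_forall fun u hu => ?_))
    have hu0 : 0 < u := zero_lt_one.trans hu
    rw [Real.norm_of_nonneg (by positivity), sub_eq_add_neg, Real.rpow_add hu0]
    exact mul_le_mul_of_nonneg_left
      (Real.rpow_le_rpow_of_nonpos hu0 (by linarith) (by linarith)) (by positivity)

/-- On the disc, the argument of `w` is controlled by the distance from `w` to `1`. -/
theorem abs_le_pi_mul_norm_one_sub_polar {r θ : ℝ} (hr0 : 0 ≤ r) (hr : r ≤ 1)
    (hθ : |θ| ≤ Real.pi) :
    |θ| ≤ Real.pi * ‖1 - (r : ℂ) * exp (I * θ)‖ := by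
  have he : ‖exp (I * θ)‖ = 1 := by rw [mul_comm]; exact norm_exp_ofReal_mul_I θ
  have hradial : 1 - r ≤ ‖1 - (r : ℂ) * exp (I * θ)‖ := by
    simpa [he, abs_of_nonneg hr0] using norm_sub_norm_le (1 : ℂ) ((r : ℂ) * exp (I * θ))
  have hdiff : ‖(r : ℂ) * exp (I * θ) - exp (I * θ)‖ = 1 - r := by
    rw [← sub_one_mul, norm_mul, he, mul_one, ← ofReal_one, ← ofReal_sub, norm_real,
      Real.norm_of_nonpos (by linarith)]
    ring
  have hchord : ‖exp (I * θ) - 1‖ ≤ 2 * ‖1 - (r : ℂ) * exp (I * θ)‖ := by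
    have := norm_sub_le_norm_sub_add_norm_sub (1 : ℂ) ((r : ℂ) * exp (I * θ)) (exp (I * θ))
    rw [norm_sub_rev]
    linarith
  rw [norm_exp_I_mul_ofReal_sub_one, Real.norm_eq_abs, abs_mul, abs_two] at hchord
  have hsin := Real.mul_abs_le_abs_sin (x := θ / 2) (by rw [abs_div, abs_two]; linarith)
  rw [abs_div, abs_two] at hsin
  have hpi := Real.pi_pos
  have : 2 / Real.pi * (|θ| / 2) = |θ| / Real.pi := by field_simp
  rw [this, div_le_iff₀ hpi] at hsin
  nlinarith

/-- The Dirichlet kernel is bounded by its number of terms on the closed disc. -/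
theorem norm_geom_sum_le {w : ℂ} (hw : ‖w‖ ≤ 1) (n : ℕ) :
    ‖∑ j ∈ Finset.range n, w ^ j‖ ≤ n := by
  refine (norm_sum_le_of_le (Finset.range n) (f := fun j => w ^ j) (n := fun _ => 1)
    fun j _ => ?_).trans_eq (by simp)
  rw [norm_pow]
  exact pow_le_one₀ (norm_nonneg _) hw

theorem norm_geom_sum_mul_norm_one_sub_le {w : ℂ} (hw : ‖w‖ ≤ 1) (n : ℕ) :
    ‖∑ j ∈ Finset.range n, w ^ j‖ * ‖1 - w‖ ≤ 2 := by
  rw [← norm_mul, geom_sum_mul_neg]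
  refine (norm_sub_le _ _).trans ?_
  rw [norm_one, norm_pow]
  linarith [pow_le_one₀ (n := n) (norm_nonneg w) hw]

/-- The square of the Dirichlet kernel decays separately in the radial and angular variables. -/
theorem norm_geom_sum_sq_le_polar {r θ : ℝ} (hr0 : 0 ≤ r) (hr : r ≤ 1) (hθ : |θ| ≤ Real.pi)
    (n : ℕ) :
    ‖∑ j ∈ Finset.range n, ((r : ℂ) * exp (I * θ)) ^ j‖ ^ 2 *
        ((1 + n * (1 - r)) * (1 + n * |θ|)) ≤
      3 * (1 + 2 * Real.pi) * (n : ℝ) ^ 2 := by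
  have hw : ‖(r : ℂ) * exp (I * θ)‖ = r := by
    rw [norm_mul, mul_comm I, norm_exp_ofReal_mul_I, norm_real, Real.norm_of_nonneg hr0, mul_one]
  have hradial : 1 - r ≤ ‖1 - (r : ℂ) * exp (I * θ)‖ := by
    simpa [hw, abs_of_nonneg hr0] using norm_sub_norm_le (1 : ℂ) ((r : ℂ) * exp (I * θ))
  have hang := abs_le_pi_mul_norm_one_sub_polar hr0 hr hθ
  have h1 := norm_geom_sum_le (hw.trans_le hr) n
  have h2 := norm_geom_sum_mul_norm_one_sub_le (hw.trans_le hr) n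
  set D := ‖∑ j ∈ Finset.range n, ((r : ℂ) * exp (I * θ)) ^ j‖
  have hD : 0 ≤ D := norm_nonneg _
  have hpi := Real.pi_pos
  have hn : (0 : ℝ) ≤ n := n.cast_nonneg
  have hDr : D * (1 - r) ≤ 2 := (mul_le_mul_of_nonneg_left hradial hD).trans h2
  have hDθ : D * |θ| ≤ 2 * Real.pi := by
    nlinarith [mul_le_mul_of_nonneg_left hang hD]
  have e1 : D * (1 + n * (1 - r)) ≤ 3 * n := by
    nlinarith [mul_le_mul_of_nonneg_left hDr hn]
  have e2 : D * (1 + n * |θ|) ≤ (1 + 2 * Real.pi) * n := by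
    nlinarith [mul_le_mul_of_nonneg_left hDθ hn]
  calc D ^ 2 * ((1 + n * (1 - r)) * (1 + n * |θ|))
      = (D * (1 + n * (1 - r))) * (D * (1 + n * |θ|)) := by ring
    _ ≤ (3 * n) * ((1 + 2 * Real.pi) * n) := mul_le_mul e1 e2 (by positivity) (by positivity)
    _ = _ := by ring

/-- The weighted Dirichlet kernel is dominated by a product of rescaled one-variable profiles. -/
theorem norm_geom_sum_rpow_mul_weight_le {β m : ℝ} (hm : 0 ≤ m) {r θ : ℝ} (hr0 : 0 ≤ r)
    (hr : r < 1) (hθ : |θ| ≤ Real.pi) {n : ℕ} (hn : 1 ≤ n) :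
    ‖∑ j ∈ Finset.range n, ((r : ℂ) * exp (I * θ)) ^ j‖ ^ (2 * m) * (1 - r ^ 2) ^ β ≤
      2 ^ |β| * (3 * (1 + 2 * Real.pi)) ^ m * (n : ℝ) ^ (2 * m - β) *
        (((n * (1 - r)) ^ β * (1 + n * (1 - r)) ^ (-m)) * (1 + n * |θ|) ^ (-m)) := by
  have hsq := norm_geom_sum_sq_le_polar hr0 hr.le hθ n
  set D := ‖∑ j ∈ Finset.range n, ((r : ℂ) * exp (I * θ)) ^ j‖
  have hD : 0 ≤ D := norm_nonneg _
  have hpi := Real.pi_pos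
  have hn0 : (0 : ℝ) < n := by exact_mod_cast hn
  have hr1 : 0 < 1 - r := by linarith
  set X := 1 + n * (1 - r)
  set Y := 1 + n * |θ|
  have hX : 0 < X := by positivity
  have hY : 0 < Y := by positivity
  have hkernel : D ^ (2 * m) ≤
      (3 * (1 + 2 * Real.pi)) ^ m * (n : ℝ) ^ (2 * m) * (X ^ (-m) * Y ^ (-m)) := by
    have h := Real.rpow_le_rpow (by positivity) hsq hm
    rw [Real.mul_rpow (by positivity) (by positivity),
      Real.mul_rpow hX.le hY.le, Real.mul_rpow (by positivity) (by positivity),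
      ← Real.rpow_natCast D, ← Real.rpow_natCast (n : ℝ),
      ← Real.rpow_mul hD, ← Real.rpow_mul hn0.le] at h
    push_cast at h
    rw [Real.rpow_neg hX.le, Real.rpow_neg hY.le, ← mul_inv, ← div_eq_mul_inv,
      le_div_iff₀ (by positivity)]
    exact h
  have hweight : (1 - r ^ 2) ^ β ≤ 2 ^ |β| * ((n : ℝ) ^ (-β) * (n * (1 - r)) ^ β) := by
    have h1 : (1 + r) ^ β ≤ 2 ^ |β| :=
      (Real.rpow_le_rpow_of_exponent_le (by linarith) (le_abs_self β)).trans
        (Real.rpow_le_rpow (by linarith) (by linarith) (abs_nonneg β))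
    rw [Real.mul_rpow hn0.le hr1.le, ← mul_assoc ((n : ℝ) ^ (-β)), ← Real.rpow_add hn0,
      neg_add_cancel, Real.rpow_zero, one_mul,
      show 1 - r ^ 2 = (1 + r) * (1 - r) by ring, Real.mul_rpow (by linarith) hr1.le]
    exact mul_le_mul_of_nonneg_right h1 (by positivity)
  refine (mul_le_mul hkernel hweight (Real.rpow_nonneg (by nlinarith) _)
    (by positivity)).trans_eq ?_
  rw [sub_eq_add_neg (2 * m), Real.rpow_add hn0]
  ring

open MeasureTheory Set in
/-- Polar coordinates bound the integral over the disc of a function dominated by a product. -/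
theorem setIntegral_ball_le_of_polar_le {f : ℂ → ℝ} (hf : ∀ w ∈ ball (0 : ℂ) 1, 0 ≤ f w)
    {a b : ℝ → ℝ} (ha : Integrable a) (hb : Integrable b) (ha0 : ∀ x, 0 ≤ a x)
    (hb0 : ∀ x, 0 ≤ b x)
    (h : ∀ r θ : ℝ, 0 ≤ r → r < 1 → |θ| ≤ Real.pi →
      f ((r : ℂ) * exp (I * θ)) ≤ a r * b θ) :
    ∫ w in ball (0 : ℂ) 1, f w ≤ (∫ x, a x) * ∫ x, b x := by
  have hint : Integrable (fun q : ℝ × ℝ => a q.1 * b q.2) := ha.mul_prod hb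
  have hnonneg : ∀ q : ℝ × ℝ, 0 ≤ a q.1 * b q.2 := fun q => mul_nonneg (ha0 _) (hb0 _)
  have hind : ∀ w, 0 ≤ (ball (0 : ℂ) 1).indicator f w := indicator_nonneg hf
  have hmeas : MeasurableSet polarCoord.target := polarCoord.open_target.measurableSet
  rw [← integral_indicator measurableSet_ball, ← Complex.integral_comp_polarCoord_symm,
    ← integral_prod_mul]
  refine (integral_mono_of_nonneg ?_ hint.integrableOn ?_).trans
    (setIntegral_le_integral hint (.of_forall hnonneg))
  · refine (ae_restrict_iff' hmeas).2 (.of_forall fun q hq => ?_)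
    exact smul_nonneg (le_of_lt hq.1) (hind _)
  · refine (ae_restrict_iff' hmeas).2 (.of_forall fun q hq => ?_)
    obtain ⟨r, θ⟩ := q
    have hr : 0 < r := hq.1
    have hθ : |θ| ≤ Real.pi := abs_le.2 ⟨hq.2.1.le, hq.2.2.le⟩
    have hpolar : Complex.polarCoord.symm (r, θ) = (r : ℂ) * exp (I * θ) := by
      rw [Complex.polarCoord_symm_apply, mul_comm I, exp_mul_I]
      simp
    have hnorm : ‖(r : ℂ) * exp (I * θ)‖ = r := by
      rw [norm_mul, mul_comm I, norm_exp_ofReal_mul_I, norm_real, Real.norm_of_nonneg hr.le,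
        mul_one]
    simp only [hpolar, smul_eq_mul]
    by_cases hr1 : r < 1
    · have hmem : (r : ℂ) * exp (I * θ) ∈ ball (0 : ℂ) 1 := by
        rwa [mem_ball_zero_iff, hnorm]
      rw [indicator_of_mem hmem]
      exact (mul_le_of_le_one_left (hf _ hmem) hr1.le).trans (h r θ hr.le hr1 hθ)
    · have hmem : (r : ℂ) * exp (I * θ) ∉ ball (0 : ℂ) 1 := by
        rwa [mem_ball_zero_iff, hnorm]
      rw [indicator_of_notMem hmem, mul_zero]
      exact hnonneg (r, θ)

/-- For `p ∈ [1, ∞)`, `β > -1` and an integer `N ≥ β + 2`, the Dirichlet kernel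
`D_n(w) = Σ_{j=0}^{n-1} w^j` satisfies
`∫_D |D_n(w)|^{2Np} (1-|w|^2)^β dA(w) ≤ C n^{2pN-2-β}`, with `dA` normalized
area measure and `C = C(p, β, N)`. -/
theorem dirichlet_kernel_bergman_estimate (p β : ℝ) (hp : 1 ≤ p) (hβ : -1 < β)
    (N : ℕ) (hN : β + 2 ≤ (N : ℝ)) :
    ∃ C : ℝ, 0 < C ∧
      ∀ n : ℕ, 1 ≤ n →
        (Real.pi⁻¹ * ∫ w in ball (0:ℂ) 1,
            ‖∑ j ∈ Finset.range n, w ^ j‖ ^ (2 * (N : ℝ) * p) *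
              (1 - ‖w‖ ^ 2) ^ β)
          ≤ C * (n : ℝ) ^ (2 * p * (N : ℝ) - 2 - β) := by
  have hN1 : 0 ≤ (N : ℝ) := N.cast_nonneg
  set m : ℝ := N * p with hm_def
  have hm : β + 2 ≤ m := hN.trans (le_mul_of_one_le_right hN1 hp)
  let A : ℝ → ℝ := (Set.Ioi 0).indicator fun u => u ^ β * (1 + u) ^ (-m)
  let B : ℝ → ℝ := fun u => (1 + ‖u‖) ^ (-m)
  have hA : MeasureTheory.Integrable A :=
    (MeasureTheory.integrable_indicator_iff measurableSet_Ioi).2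
      (integrableOn_Ioi_rpow_mul_one_add_rpow_neg hβ (by linarith))
  have hB : MeasureTheory.Integrable B :=
    integrable_one_add_norm (by rw [Module.finrank_self, Nat.cast_one]; linarith)
  have hA0 : ∀ u, 0 ≤ A u := Set.indicator_nonneg fun u hu => by
    have : 0 < u := hu
    positivity
  have hB0 : ∀ u, 0 ≤ B u := fun u => by positivity
  set K : ℝ := 2 ^ |β| * (3 * (1 + 2 * Real.pi)) ^ m
  have hpi := Real.pi_pos
  have hK : 0 < K := by positivity
  have hIA : 0 ≤ ∫ u, A u := MeasureTheory.integral_nonneg hA0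
  have hIB : 0 ≤ ∫ u, B u := MeasureTheory.integral_nonneg hB0
  refine ⟨Real.pi⁻¹ * (K * ((∫ u, A u) * ∫ u, B u)) + 1, by positivity, fun n hn => ?_⟩
  have hn0 : (0 : ℝ) < n := by exact_mod_cast hn
  have hAn : MeasureTheory.Integrable fun r : ℝ => A (n * (1 - r)) :=
    (hA.comp_mul_left' hn0.ne').comp_sub_left 1
  have hBn : MeasureTheory.Integrable fun θ : ℝ => B (n * θ) := hB.comp_mul_left' hn0.ne'
  have hIAn : ∫ r : ℝ, A (n * (1 - r)) = (n : ℝ)⁻¹ * ∫ u, A u := by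
    rw [MeasureTheory.integral_sub_left_eq_self (fun t : ℝ => A (n * t)),
      MeasureTheory.Measure.integral_comp_mul_left, abs_of_pos (by positivity), smul_eq_mul]
  have hIBn : ∫ θ : ℝ, B (n * θ) = (n : ℝ)⁻¹ * ∫ u, B u := by
    rw [MeasureTheory.Measure.integral_comp_mul_left, abs_of_pos (by positivity), smul_eq_mul]
  have hball := setIntegral_ball_le_of_polar_le
    (f := fun w => ‖∑ j ∈ Finset.range n, w ^ j‖ ^ (2 * (N : ℝ) * p) * (1 - ‖w‖ ^ 2) ^ β)
    (fun w hw => by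
      have hw1 : ‖w‖ < 1 := by rwa [mem_ball_zero_iff] at hw
      have : 0 ≤ 1 - ‖w‖ ^ 2 := by nlinarith [norm_nonneg w]
      positivity)
    (hAn.const_mul (K * (n : ℝ) ^ (2 * m - β))) hBn
    (fun r => mul_nonneg (by positivity) (hA0 _)) (fun θ => hB0 _)
    (fun r θ hr0 hr hθ => by
      have hnorm : ‖(r : ℂ) * exp (I * θ)‖ = r := by
        rw [norm_mul, mul_comm I, norm_exp_ofReal_mul_I, norm_real, Real.norm_of_nonneg hr0,
          mul_one]
      have hmem : (n : ℝ) * (1 - r) ∈ Set.Ioi (0 : ℝ) := mul_pos hn0 (by linarith)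
      have hbound := norm_geom_sum_rpow_mul_weight_le (β := β) (m := m) (by linarith) hr0 hr hθ hn
      simp only [hnorm, A, B, Set.indicator_of_mem hmem]
      rw [mul_assoc 2 (N : ℝ) p, norm_mul, Real.norm_of_nonneg hn0.le, Real.norm_eq_abs,
        mul_assoc (K * _)]
      exact hbound)
  rw [MeasureTheory.integral_const_mul, hIAn, hIBn] at hball
  have hpow : (n : ℝ) ^ (2 * p * (N : ℝ) - 2 - β) =
      (n : ℝ) ^ (2 * m - β) * ((n : ℝ)⁻¹ * (n : ℝ)⁻¹) := by
    rw [show 2 * p * (N : ℝ) - 2 - β = (2 * m - β) + (-1 + -1) by rw [hm_def]; ring,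
      Real.rpow_add hn0, Real.rpow_add hn0, Real.rpow_neg_one]
  calc _ ≤ Real.pi⁻¹ * (K * (n : ℝ) ^ (2 * m - β) * ((n : ℝ)⁻¹ * ∫ u, A u) *
        ((n : ℝ)⁻¹ * ∫ u, B u)) := mul_le_mul_of_nonneg_left hball (by positivity)
    _ = Real.pi⁻¹ * (K * ((∫ u, A u) * ∫ u, B u)) * (n : ℝ) ^ (2 * p * (N : ℝ) - 2 - β) := by
      rw [hpow]; ring
    _ ≤ _ := mul_le_mul_of_nonneg_right (by linarith) (by positivity)
end
end

section
/- Let f be a bounded holomorphic function on D and let n ≥ 1. Then every bounded holomorphic function g on D whose Taylor coefficients at 0 satisfy ĝ(k) = f̂(k) for all 0 ≤ k ≤ n−1 satisfies sup_{z∈D} |g(z)| ≥ | Σ_{k=0}^{n−1} (1 − k/n) · f̂(k) |. (The Fejér-kernel lower bound for the quotient norm ‖f‖_{H^∞ / z^n H^∞} used in Step 3 of Section 6: ‖g‖_∞ ≥ ‖f ∗ F_n‖_∞ ≥ |(f ∗ F_n)(1)|, where F_n is the n-th Fejér kernel.) -/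
open Complex Metric

noncomputable section

/-- Circle averages satisfy the triangle inequality. -/
lemma norm_circleAverage_le_circleAverage_norm (f : ℂ → ℂ) (c : ℂ) (R : ℝ) :
    ‖Real.circleAverage f c R‖ ≤ Real.circleAverage (fun z ↦ ‖f z‖) c R := by
  rw [Real.circleAverage, Real.circleAverage, norm_smul, smul_eq_mul, Real.norm_of_nonneg (by positivity)]
  gcongr
  exact intervalIntegral.norm_integral_le_integral_norm Real.two_pi_pos.le

/-- The nonnegative Fourier coefficients of the restriction of a holomorphic function to a circle
are its scaled Taylor coefficients, and the negative ones vanish. -/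
lemma circleAverage_mul_pow_mul_inv_pow {h : ℂ → ℂ} {r : ℝ} (hr : 0 < r)
    (hh : DiffContOnCl ℂ h (ball 0 r)) (i j : ℕ) :
    Real.circleAverage (fun z ↦ h z * ((z / r) ^ i * ((z / r)⁻¹) ^ j)) 0 r =
      if i ≤ j then iteratedDeriv (j - i) h 0 / ((j - i).factorial : ℂ) * (r : ℂ) ^ (j - i)
      else 0 := by
  have hr' : (r : ℂ) ≠ 0 := by exact_mod_cast hr.ne'
  have hz0 {z : ℂ} (hz : z ∈ sphere (0 : ℂ) r) : z ≠ 0 := by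
    rintro rfl
    simp at hz
    exact hr.ne hz
  split_ifs with hij
  · obtain ⟨k, rfl⟩ := Nat.exists_eq_add_of_le hij
    have hcongr : (∮ z in C(0, r), (z - 0)⁻¹ • (h z * ((z / r) ^ i * ((z / r)⁻¹) ^ (i + k)))) =
        ∮ z in C(0, r), (r : ℂ) ^ k • ((1 / (z - 0) ^ (k + 1)) • h z) := by
      refine circleIntegral.integral_congr hr.le fun z hz ↦ ?_
      have := hz0 hz
      simp only [smul_eq_mul, sub_zero]
      rw [pow_add, ← mul_assoc ((z / r) ^ i), ← mul_pow, mul_inv_cancel₀ (by positivity), one_pow, inv_div,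
        div_pow]
      field_simp
      ring
    rw [Real.circleAverage_eq_circleIntegral hr.ne', hcongr, circleIntegral.integral_smul,
      hh.circleIntegral_one_div_sub_center_pow_smul hr k]
    have := Real.pi_ne_zero
    simp only [smul_eq_mul, Nat.add_sub_cancel_left]
    field_simp [Complex.I_ne_zero]
  · obtain ⟨k, rfl⟩ := Nat.exists_eq_add_of_lt (not_le.1 hij)
    have hd : DiffContOnCl ℂ (fun z ↦ h z * (z / r) ^ (k + 1)) (ball 0 |r|) := by
      rw [abs_of_pos hr]
      exact hh.smul (Differentiable.diffContOnCl (f := fun z : ℂ ↦ (z / r) ^ (k + 1))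
        (by fun_prop))
    refine Eq.trans ?_ (hd.circleAverage.trans (by simp))
    refine Real.circleAverage_congr_sphere fun z hz ↦ ?_
    rw [abs_of_pos hr] at hz
    have := hz0 hz
    have hk : (z / r) ^ j * ((z / r)⁻¹) ^ j = 1 := by
      rw [← mul_pow, mul_inv_cancel₀ (by positivity), one_pow]
    rw [add_assoc, pow_add]
    linear_combination h z * (z / r) ^ (k + 1) * hk

/-- Summing the first `n` partial sums of a sequence gives `n` times its Cesàro mean. -/
lemma sum_range_sum_range_succ (b : ℕ → ℂ) (n : ℕ) :
    ∑ j ∈ Finset.range n, ∑ k ∈ Finset.range (j + 1), b k =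
      ∑ k ∈ Finset.range n, ((n : ℂ) - k) * b k := by
  induction n with
  | zero => simp
  | succ n ih =>
    rw [Finset.sum_range_succ, ih, Finset.sum_range_succ, Finset.sum_range_succ, ← add_assoc,
      ← Finset.sum_add_distrib]
    push_cast
    congr 1
    · exact Finset.sum_congr rfl fun k _ ↦ by ring
    · ring

/-- Integrating a holomorphic function over a circle against the square of the modulus of the
Dirichlet polynomial `∑_{j<n} (z/r)^j`. -/
lemma circleAverage_mul_normSq_sum_pow {h : ℂ → ℂ} {r : ℝ} (hr : 0 < r)
    (hh : DiffContOnCl ℂ h (ball 0 r)) (n : ℕ) :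
    Real.circleAverage
        (fun z ↦ h z * ((‖∑ j ∈ Finset.range n, (z / r) ^ j‖ ^ 2 : ℝ) : ℂ)) 0 r =
      ∑ k ∈ Finset.range n,
        ((n : ℂ) - k) * (iteratedDeriv k h 0 / (k.factorial : ℂ) * (r : ℂ) ^ k) := by
  have hr' : (r : ℂ) ≠ 0 := by exact_mod_cast hr.ne'
  have hcont : ContinuousOn h (sphere 0 r) := by
    have := hh.continuousOn
    rw [closure_ball _ hr.ne'] at this
    exact this.mono sphere_subset_closedBall
  have hz0 : ∀ z ∈ sphere (0 : ℂ) r, z / r ≠ 0 := by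
    rintro z hz
    refine div_ne_zero ?_ hr'
    rintro rfl
    simp at hz
    exact hr.ne hz
  have hint (i j : ℕ) :
      CircleIntegrable (fun z ↦ h z * ((z / r) ^ i * ((z / r)⁻¹) ^ j)) 0 r := by
    refine ContinuousOn.circleIntegrable hr.le ?_
    have hinv : ContinuousOn (fun z : ℂ ↦ (z / r)⁻¹) (sphere 0 r) :=
      ContinuousOn.inv₀ (by fun_prop) hz0
    fun_prop
  rw [← sum_range_sum_range_succ]
  have hexp : Real.circleAverage
      (fun z ↦ h z * ((‖∑ j ∈ Finset.range n, (z / r) ^ j‖ ^ 2 : ℝ) : ℂ)) 0 r =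
      Real.circleAverage (fun z ↦ ∑ j ∈ Finset.range n, ∑ i ∈ Finset.range n,
        h z * ((z / r) ^ i * ((z / r)⁻¹) ^ j)) 0 r := by
    refine Real.circleAverage_congr_sphere fun z hz ↦ ?_
    rw [abs_of_pos hr, mem_sphere_zero_iff_norm] at hz
    have hconj : (starRingEnd ℂ) (z / r) = (z / r)⁻¹ := by
      refine (Complex.inv_eq_conj ?_).symm
      rw [norm_div, hz, Complex.norm_real, Real.norm_of_nonneg hr.le, div_self hr.ne']
    rw [Complex.ofReal_pow, ← Complex.mul_conj', map_sum, Finset.sum_mul_sum, Finset.sum_comm,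
      Finset.mul_sum]
    refine Finset.sum_congr rfl fun j _ ↦ ?_
    rw [Finset.mul_sum]
    exact Finset.sum_congr rfl fun i _ ↦ by rw [map_pow, hconj]
  rw [hexp, Real.circleAverage_fun_sum
    fun j _ ↦ CircleIntegrable.fun_sum _ fun i _ ↦ hint i j]
  refine Finset.sum_congr rfl fun j hj ↦ ?_
  rw [Real.circleAverage_fun_sum fun i _ ↦ hint i j]
  simp only [circleAverage_mul_pow_mul_inv_pow hr hh]
  rw [Finset.sum_ite, Finset.sum_const_zero, add_zero]
  have hfil : (Finset.range n).filter (· ≤ j) = Finset.range (j + 1) := by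
    ext i
    simp only [Finset.mem_filter, Finset.mem_range] at hj ⊢
    omega
  rw [hfil, ← Finset.sum_range_reflect
    (fun k ↦ iteratedDeriv k h 0 / (k.factorial : ℂ) * (r : ℂ) ^ k)]
  refine Finset.sum_congr rfl fun i hi ↦ ?_
  simp

/-- The Fejér mean bound on a circle of radius `r`. -/
lemma norm_sum_sub_mul_iteratedDeriv_le {h : ℂ → ℂ} {r M : ℝ} (hr : 0 < r)
    (hh : DiffContOnCl ℂ h (ball 0 r)) (hM : ∀ z ∈ sphere (0 : ℂ) r, ‖h z‖ ≤ M) (n : ℕ) :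
    ‖∑ k ∈ Finset.range n,
        ((n : ℂ) - k) * (iteratedDeriv k h 0 / (k.factorial : ℂ) * (r : ℂ) ^ k)‖ ≤ M * n := by
  have hcont : ContinuousOn h (sphere 0 r) := by
    have := hh.continuousOn
    rw [closure_ball _ hr.ne'] at this
    exact this.mono sphere_subset_closedBall
  set D : ℂ → ℝ := fun z ↦ ‖∑ j ∈ Finset.range n, (z / r) ^ j‖ ^ 2 with hD
  have hDc : Continuous D := by fun_prop
  have hDi : CircleIntegrable D 0 r := hDc.continuousOn.circleIntegrable hr.le
  have hDavg : Real.circleAverage D 0 r = n := by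
    have h1 := circleAverage_mul_normSq_sum_pow hr (diffContOnCl_const (c := (1 : ℂ))) n
    have h2 := Complex.ofRealCLM.circleAverage_comp_comm hDi
    rw [Finset.sum_eq_single 0] at h1
    · simp only [one_mul] at h1
      refine Complex.ofReal_injective ?_
      refine (h2.symm.trans h1).trans ?_
      simp
    · intro k _ hk
      simp [iteratedDeriv_const, hk]
    · intro hn
      simp_all
  rw [← circleAverage_mul_normSq_sum_pow hr hh n]
  calc _ ≤ Real.circleAverage (fun z ↦ ‖h z * (D z : ℂ)‖) 0 r :=
        norm_circleAverage_le_circleAverage_norm _ _ _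
    _ ≤ Real.circleAverage (fun z ↦ M • D z) 0 r := by
        refine Real.circleAverage_mono ?_ ?_ fun z hz ↦ ?_
        · refine ContinuousOn.circleIntegrable hr.le ?_
          fun_prop
        · exact Continuous.continuousOn (by fun_prop) |>.circleIntegrable hr.le
        · rw [abs_of_pos hr] at hz
          have hDz : 0 ≤ D z := by positivity
          rw [norm_mul, Complex.norm_real, Real.norm_of_nonneg hDz]
          exact mul_le_mul_of_nonneg_right (hM z hz) hDz
    _ = M * n := by rw [Real.circleAverage_fun_smul, hDavg, smul_eq_mul]

/-- The Fejér-kernel lower bound for the quotient norm `‖f‖_{H^∞/z^n H^∞}`: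
if `g` is bounded holomorphic on `D` and its first `n` Taylor coefficients agree
with those of a bounded holomorphic `f`, then
`sup_{z ∈ D} |g(z)| ≥ |Σ_{k=0}^{n-1} (1 - k/n) f̂(k)|`. -/
theorem fejer_quotient_norm_lower_bound (n : ℕ) (hn : 1 ≤ n) (f g : ℂ → ℂ)
    (hf : DifferentiableOn ℂ f (ball (0:ℂ) 1))
    (hfb : ∃ M : ℝ, ∀ z ∈ ball (0:ℂ) 1, ‖f z‖ ≤ M)
    (hg : DifferentiableOn ℂ g (ball (0:ℂ) 1))
    -- `ĝ(k) = f̂(k)` for `0 ≤ k ≤ n-1`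
    (hcoef : ∀ k < n, iteratedDeriv k g 0 = iteratedDeriv k f 0) :
    ∀ M : ℝ, (∀ z ∈ ball (0:ℂ) 1, ‖g z‖ ≤ M) →
      ‖∑ k ∈ Finset.range n,
          (1 - (k : ℂ) / (n : ℂ)) * (iteratedDeriv k f 0 / (k.factorial : ℂ))‖
        ≤ M := by
  intro M hM
  have hn0 : (0 : ℝ) < n := by exact_mod_cast hn
  set S : ℝ → ℂ := fun r ↦ ∑ k ∈ Finset.range n,
    ((n : ℂ) - k) * (iteratedDeriv k g 0 / (k.factorial : ℂ) * (r : ℂ) ^ k) with hS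
  have hSc : Continuous fun r ↦ ‖S r‖ := by fun_prop
  have hlim : ‖S 1‖ ≤ M * n := by
    refine le_of_tendsto (hSc.continuousWithinAt (s := Set.Iio 1) (x := 1)) ?_
    filter_upwards [Ioo_mem_nhdsLT (zero_lt_one (α := ℝ))] with r hr
    refine norm_sum_sub_mul_iteratedDeriv_le hr.1 ?_ (fun z hz ↦ hM z ?_) n
    · refine DifferentiableOn.diffContOnCl (hg.mono ?_)
      rw [closure_ball _ hr.1.ne']
      exact closedBall_subset_ball hr.2
    · exact closedBall_subset_ball hr.2 (sphere_subset_closedBall hz)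
  have hsum : ∑ k ∈ Finset.range n,
      (1 - (k : ℂ) / (n : ℂ)) * (iteratedDeriv k f 0 / (k.factorial : ℂ)) = S 1 / n := by
    rw [hS, Finset.sum_div]
    refine Finset.sum_congr rfl fun k hk ↦ ?_
    rw [hcoef k (Finset.mem_range.1 hk)]
    have : (n : ℂ) ≠ 0 := by exact_mod_cast hn0.ne'
    field_simp
    simp
  rw [hsum, norm_div, Complex.norm_natCast, div_le_iff₀ hn0]
  exact hlim
end
end
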